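/- Let μ₁,…,μ_J be probability measures on [0,1] and F ∈ C(ℝ^J) satisfy the convexity-ellipticity structure with functions α_j and constant θ₀ > 0. Let f and g₁,…,g_J be Lipschitz functions in B_R and let u ∈ C^∞(ℝ^n) ∩ W^{2,∞}(ℝ^n) solve F( 𝓛_{μ₁}u(x) − g₁(x), …, 𝓛_{μ_J}u(x) − g_J(x) ) = f(x) for all x ∈ B_R. Set g(x) := −F(−g₁(x),…,−g_J(x)). Then sup_{B_{R/2}} |∇u| ≤ C( (ω₀ + R^{-1})‖u‖_{L^∞(ℝ^n)} + (1+R)R^{-1}‖(f+g)₋‖_{L^∞(B_R)}^{1/2}‖u‖_{L^∞(B_R)}^{1/2} + (1+R²)γ₁ ) for some constant C depending only on n and θ₀. If, in addition, f and all g_j are semiconcave in B_R, then for every e ∈ ℝ^n with |e| = 1, sup_{B_{R/2}} ∂²_e u ≤ C( (ω₀ + R^{-1})R^{-1}‖u‖_{L^∞(ℝ^n)} + (1+R)R^{-2}‖(f+g)₋‖_{L^∞(B_R)}^{1/2}‖u‖_{L^∞(B_R)}^{1/2} + (1+R²)(R^{-1}γ₁ + γ₂) ), with C as before. -/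

import Mathlib

open MeasureTheory Filter Metric Set

noncomputable section

/-- Euclidean space `ℝⁿ`. -/
abbrev En (n : ℕ) := EuclideanSpace ℝ (Fin n)

/-- Principal value integral centered at `x`: the limit, as `ε → 0⁺`, of the integrals
over the complement of the `ε`-ball centered at `x`. -/
def pvAt (n : ℕ) (x : En n) (g : En n → ℝ) : ℝ :=
  limUnder (nhdsWithin (0:ℝ) (Set.Ioi 0))
    (fun ε => ∫ y in {y : En n | ε ≤ dist y x}, g y)

/-- Integro-differential operator with kernel `K`:
`𝓛_K u (x) = P.V. ∫ (u x - u y) K (x - y) dy`. -/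
def opK (n : ℕ) (K : En n → ℝ) (u : En n → ℝ) (x : En n) : ℝ :=
  pvAt n x (fun y => (u x - u y) * K (x - y))

/-- The normalizing constant `c_{n,s}` of the fractional Laplacian, for which the
Fourier symbol is `|ξ|^{2s}`. -/
def cns (n : ℕ) (s : ℝ) : ℝ :=
  (4:ℝ) ^ s * s * Real.Gamma ((n:ℝ)/2 + s) / (Real.pi ^ ((n:ℝ)/2) * Real.Gamma (1 - s))

/-- The fractional Laplacian `(-Δ)^s`, for `s ∈ (0,1)`. -/
def fracLap (n : ℕ) (s : ℝ) (u : En n → ℝ) (x : En n) : ℝ :=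
  opK n (fun z => cns n s * ‖z‖ ^ (-((n:ℝ) + 2*s))) u x

/-- Directional derivative `∂_e u`. -/
def dd (n : ℕ) (e : En n) (u : En n → ℝ) (x : En n) : ℝ := fderiv ℝ u x e

/-- Second directional derivative `∂²_e u`. -/
def dd2 (n : ℕ) (e : En n) (u : En n → ℝ) (x : En n) : ℝ := fderiv ℝ (dd n e u) x e

/-- `‖η‖_{C²(ℝⁿ)} ≤ M`. -/
def C2BddBy (n : ℕ) (η : En n → ℝ) (M : ℝ) : Prop :=
  ∀ x : En n, |η x| ≤ M ∧ ‖fderiv ℝ η x‖ ≤ M ∧ ‖fderiv ℝ (fderiv ℝ η) x‖ ≤ M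

/-- The kernel `K` is even and has two-sided power bounds with constants `C₁ ≤ C₂`:
`K(z) = K(-z)` and `C₁ s(1-s)|z|^{-n-2s} ≤ K(z) ≤ C₂ s(1-s)|z|^{-n-2s}` for `z ≠ 0`. -/
def evenPowKernel (n : ℕ) (s C₁ C₂ : ℝ) (K : En n → ℝ) : Prop :=
  (∀ z : En n, z ≠ 0 → K z = K (-z)) ∧
  (∀ z : En n, z ≠ 0 →
    C₁ * (s * (1 - s)) * ‖z‖ ^ (-((n:ℝ) + 2*s)) ≤ K z ∧
    K z ≤ C₂ * (s * (1 - s)) * ‖z‖ ^ (-((n:ℝ) + 2*s)))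

/-- `K ∈ C²(ℝⁿ \ {0})` with `|z||∇K(z)| + |z|²|D²K(z)| ≤ C₃ K(z)` for `z ≠ 0`. -/
def kernelDerivBdd (n : ℕ) (C₃ : ℝ) (K : En n → ℝ) : Prop :=
  ContDiffOn ℝ 2 K {z : En n | z ≠ 0} ∧
  ∀ z : En n, z ≠ 0 →
    ‖z‖ * ‖fderiv ℝ K z‖ + ‖z‖^2 * ‖fderiv ℝ (fderiv ℝ K) z‖ ≤ C₃ * K z

/-- `(-Δ) u (x)` computed through the liminf of second incremental quotients
(which equals `-Δu(x)` whenever `u` is `C²` near `x`). -/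
def negLapInc (n : ℕ) (u : En n → ℝ) (x : En n) : ℝ :=
  Filter.liminf (fun h : ℝ =>
      ∑ i : Fin n, (2 * u x - u (x + h • EuclideanSpace.single i 1)
        - u (x - h • EuclideanSpace.single i 1)) / h ^ 2)
    (nhdsWithin (0:ℝ) (Set.Ioi 0))

/-- The fractional Laplacian `(-Δ)^s` for `s ∈ [0,1]`, with the conventions
`(-Δ)^0 = Id` and `(-Δ)^1 = -Δ` (the latter via second incremental quotients). -/
def fracLapE (n : ℕ) (s : ℝ) (u : En n → ℝ) (x : En n) : ℝ :=
  if s = 0 then u x else if s = 1 then negLapInc n u x else fracLap n s u x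

/-- The operator `𝓛_μ u (x) = ∫₀¹ (-Δ)^s u (x) dμ(s)` for a measure `μ` on `[0,1]`. -/
def opMu (n : ℕ) (μ : Measure ℝ) (u : En n → ℝ) (x : En n) : ℝ :=
  ∫ s, fracLapE n s u x ∂μ

/-! ### A smooth radial mollifier and the associated averages -/

/-- A smooth radial cutoff supported in the closed unit ball. -/
def cutoff (n : ℕ) (z : En n) : ℝ := Real.smoothTransition (1 - ‖z‖ ^ 2)

/-- The mollifier: the normalized square of the cutoff. -/
def moll (n : ℕ) (z : En n) : ℝ := cutoff n z ^ 2 / ∫ y, cutoff n y ^ 2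

/-- The average of `φ` at scale `r` around `x`, weighted by the mollifier. -/
def avg (n : ℕ) (r : ℝ) (φ : En n → ℝ) (x : En n) : ℝ := ∫ z, φ (x + r • z) * moll n z

lemma cutoff_contDiff (n : ℕ) : ContDiff ℝ (⊤ : ℕ∞) (cutoff n) :=
  Real.smoothTransition.contDiff.comp (contDiff_const.sub (contDiff_norm_sq ℝ))

lemma cutoff_zero_of_one_le (n : ℕ) {z : En n} (hz : 1 ≤ ‖z‖) : cutoff n z = 0 :=
  Real.smoothTransition.zero_of_nonpos (by nlinarith)

lemma hasCompactSupport_of_zero_of_one_le {n : ℕ} {ρ : En n → ℝ}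
    (h : ∀ z, 1 ≤ ‖z‖ → ρ z = 0) : HasCompactSupport ρ :=
  HasCompactSupport.intro (isCompact_closedBall (0 : En n) 1) fun z hz => h z (by
    simp only [mem_closedBall, dist_zero_right, not_le] at hz
    exact hz.le)

lemma cutoff_hasCompactSupport (n : ℕ) : HasCompactSupport (cutoff n) :=
  hasCompactSupport_of_zero_of_one_le fun _ => cutoff_zero_of_one_le n

lemma integral_cutoff_sq_pos (n : ℕ) : 0 < ∫ y, cutoff n y ^ 2 := by
  refine Continuous.integral_pos_of_hasCompactSupport_nonneg_nonzero (x := (0 : En n))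
    ((cutoff_contDiff n).continuous.pow 2)
    (hasCompactSupport_of_zero_of_one_le fun z hz => by simp [cutoff_zero_of_one_le n hz])
    (fun z => sq_nonneg _) ?_
  have : cutoff n 0 = 1 := Real.smoothTransition.one_of_one_le (by simp)
  simp [this]

lemma moll_contDiff (n : ℕ) : ContDiff ℝ (⊤ : ℕ∞) (moll n) :=
  ((cutoff_contDiff n).pow 2).div_const _

lemma moll_continuous (n : ℕ) : Continuous (moll n) := (moll_contDiff n).continuous

lemma moll_nonneg (n : ℕ) (z : En n) : 0 ≤ moll n z :=
  div_nonneg (sq_nonneg _) (integral_cutoff_sq_pos n).le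

lemma moll_zero_of_one_le (n : ℕ) {z : En n} (hz : 1 ≤ ‖z‖) : moll n z = 0 := by
  simp [moll, cutoff_zero_of_one_le n hz]

lemma moll_congr_norm (n : ℕ) {z y : En n} (h : ‖z‖ = ‖y‖) : moll n z = moll n y := by
  simp [moll, cutoff, h]

lemma moll_hasCompactSupport (n : ℕ) : HasCompactSupport (moll n) :=
  hasCompactSupport_of_zero_of_one_le fun _ => moll_zero_of_one_le n

lemma integral_moll (n : ℕ) : ∫ z, moll n z = 1 := by
  simp only [moll, integral_div]
  exact div_self (integral_cutoff_sq_pos n).ne'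

lemma integrable_mul_moll {n : ℕ} {ψ : En n → ℝ} (hψ : Continuous ψ) :
    Integrable fun z => ψ z * moll n z :=
  (hψ.mul (moll_continuous n)).integrable_of_hasCompactSupport (moll_hasCompactSupport n).mul_left

lemma integrable_avg {n : ℕ} {φ : En n → ℝ} (hφ : Continuous φ) (r : ℝ) (x : En n) :
    Integrable fun z => φ (x + r • z) * moll n z :=
  integrable_mul_moll (by fun_prop)

lemma integral_mul_moll_mono {n : ℕ} {ψ₁ ψ₂ : En n → ℝ} (h₁ : Continuous ψ₁) (h₂ : Continuous ψ₂)
    (h : ∀ z, ‖z‖ < 1 → ψ₁ z ≤ ψ₂ z) : ∫ z, ψ₁ z * moll n z ≤ ∫ z, ψ₂ z * moll n z := by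
  refine integral_mono (integrable_mul_moll h₁) (integrable_mul_moll h₂) fun z => ?_
  rcases lt_or_ge ‖z‖ 1 with hz | hz
  · exact mul_le_mul_of_nonneg_right (h z hz) (moll_nonneg n z)
  · simp [moll_zero_of_one_le n hz]

lemma integral_mul_moll_neg {n : ℕ} (ψ : En n → ℝ) :
    ∫ z, ψ (-z) * moll n z = ∫ z, ψ z * moll n z := by
  rw [← integral_neg_eq_self fun z => ψ z * moll n z]
  exact integral_congr_ae (.of_forall fun z => by
    simp only [moll_congr_norm n (norm_neg z)])

lemma integral_const_mul_moll {n : ℕ} (c : ℝ) : ∫ z : En n, c * moll n z = c := by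
  rw [integral_const_mul, integral_moll, mul_one]

lemma integral_inner_mul_moll {n : ℕ} (v : En n) : ∫ z, inner ℝ v z * moll n z = 0 := by
  have h := integral_mul_moll_neg (n := n) (fun z => inner ℝ v z)
  simp only [inner_neg_right, neg_mul, integral_neg] at h
  linarith

/-! ### Integration by parts for averages -/

lemma dd_comp_affine {n : ℕ} {φ : En n → ℝ} (hφ : ContDiff ℝ 1 φ) (e x : En n) (r : ℝ) (z : En n) :
    fderiv ℝ (fun z => φ (x + r • z)) z e = r * dd n e φ (x + r • z) := by
  have h1 : HasFDerivAt (fun z : En n => x + r • z) (r • ContinuousLinearMap.id ℝ (En n)) z :=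
    ((hasFDerivAt_id z).const_smul r).const_add x
  have h2 := ((hφ.differentiable (by simp)) (x + r • z)).hasFDerivAt.comp z h1
  have h3 : fderiv ℝ (fun z => φ (x + r • z)) z = _ := h2.fderiv
  rw [h3]
  simp [dd]

lemma integral_dd_mul {n : ℕ} {φ ρ : En n → ℝ} (hφ : ContDiff ℝ 1 φ) (hρ : ContDiff ℝ 1 ρ)
    (hc : HasCompactSupport ρ) (e x : En n) (r : ℝ) :
    r * ∫ z, dd n e φ (x + r • z) * ρ z = - ∫ z, φ (x + r • z) * dd n e ρ z := by
  have hφ' : ContDiff ℝ 1 (fun z : En n => φ (x + r • z)) := by fun_prop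
  have hd : Continuous fun z => fderiv ℝ ρ z e := (hρ.continuous_fderiv (by simp)).clm_apply continuous_const
  have hdc : HasCompactSupport fun z => fderiv ℝ ρ z e := hc.fderiv_apply ℝ e
  have hd' : Continuous fun z => fderiv ℝ (fun z : En n => φ (x + r • z)) z e :=
    (hφ'.continuous_fderiv (by simp)).clm_apply continuous_const
  have key := integral_mul_fderiv_eq_neg_fderiv_mul_of_integrable (μ := volume)
    (f := fun z : En n => φ (x + r • z)) (g := ρ) (v := e)
    ((hd'.mul hρ.continuous).integrable_of_hasCompactSupport hc.mul_left)
    ((hφ'.continuous.mul hd).integrable_of_hasCompactSupport hdc.mul_left)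
    ((hφ'.continuous.mul hρ.continuous).integrable_of_hasCompactSupport hc.mul_left)
    (fun z _ => hφ'.differentiable (by simp) z)
    (fun z _ => hρ.differentiable (by simp) z)
  simp only [dd_comp_affine hφ] at key
  simp only [dd] at key ⊢
  rw [key, neg_neg, ← integral_const_mul]
  simp only [mul_assoc]

lemma dd_contDiff {n : ℕ} {φ : En n → ℝ} (hφ : ContDiff ℝ (⊤ : ℕ∞) φ) (e : En n) :
    ContDiff ℝ (⊤ : ℕ∞) (dd n e φ) :=
  (hφ.fderiv_right (m := (⊤ : ℕ∞)) (by exact_mod_cast le_rfl)).clm_apply contDiff_const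

lemma abs_avg_le {n : ℕ} {φ : En n → ℝ} (hφ : Continuous φ) {M r : ℝ} {x : En n}
    (hM : ∀ y, |φ y| ≤ M) : |avg n r φ x| ≤ M := by
  rw [abs_le]
  constructor
  · have := integral_mul_moll_mono (n := n) (ψ₁ := fun _ => -M) (ψ₂ := fun z => φ (x + r • z))
      continuous_const (by fun_prop) (fun z _ => (abs_le.1 (hM _)).1)
    rwa [integral_const_mul_moll] at this
  · have := integral_mul_moll_mono (n := n) (ψ₂ := fun _ => M) (ψ₁ := fun z => φ (x + r • z))
      (by fun_prop) continuous_const (fun z _ => (abs_le.1 (hM _)).2)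
    rwa [integral_const_mul_moll] at this

lemma abs_integral_mul_le {n : ℕ} {φ ρ D : En n → ℝ} {M : ℝ} (hM : ∀ z, |φ z| ≤ M)
    (hD : Integrable D) (hρ : ∀ z, |ρ z| ≤ D z) : |∫ z, φ z * ρ z| ≤ M * ∫ z, D z := by
  have hM0 : 0 ≤ M := (abs_nonneg _).trans (hM 0)
  rw [← integral_const_mul]
  rw [← Real.norm_eq_abs]
  refine norm_integral_le_of_norm_le (hD.const_mul M) (.of_forall fun z => ?_)
  rw [norm_mul]
  exact mul_le_mul (hM _) (hρ z) (norm_nonneg _) hM0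

lemma abs_dd_le {n : ℕ} {e : En n} (he : ‖e‖ = 1) (φ : En n → ℝ) (z : En n) :
    |dd n e φ z| ≤ ‖fderiv ℝ φ z‖ := by
  have := (fderiv ℝ φ z).le_opNorm e
  rwa [he, mul_one] at this

lemma dd_dd_eq {n : ℕ} {φ : En n → ℝ} (hφ : ContDiff ℝ (⊤ : ℕ∞) φ) (e e' : En n) (z : En n) :
    dd n e (dd n e' φ) z = fderiv ℝ (fderiv ℝ φ) z e e' := by
  have h : DifferentiableAt ℝ (fderiv ℝ φ) z :=
    (hφ.fderiv_right (m := (⊤ : ℕ∞)) (by exact_mod_cast le_rfl)).differentiable (by simp) z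
  unfold dd
  rw [fderiv_clm_apply h (differentiableAt_const e')]
  simp

lemma abs_dd_dd_le {n : ℕ} {φ : En n → ℝ} (hφ : ContDiff ℝ (⊤ : ℕ∞) φ) {e e' : En n}
    (he : ‖e‖ = 1) (he' : ‖e'‖ = 1) (z : En n) :
    |dd n e (dd n e' φ) z| ≤ ‖fderiv ℝ (fderiv ℝ φ) z‖ := by
  rw [dd_dd_eq hφ]
  have h1 := (fderiv ℝ (fderiv ℝ φ) z e).le_opNorm e'
  have h2 := (fderiv ℝ (fderiv ℝ φ) z).le_opNorm e
  rw [he', mul_one] at h1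
  rw [he, mul_one] at h2
  exact h1.trans h2

lemma exists_avg_dd_le (n : ℕ) : ∃ C : ℝ, 0 < C ∧ ∀ (e : En n), ‖e‖ = 1 →
    ∀ φ : En n → ℝ, ContDiff ℝ (⊤ : ℕ∞) φ → ∀ M : ℝ, (∀ y, |φ y| ≤ M) → ∀ (r : ℝ), 0 < r → ∀ x,
    |avg n r (dd n e φ) x| ≤ C * M / r ∧ |avg n r (dd n e (dd n e φ)) x| ≤ C * M / r ^ 2 := by
  have hG := moll_contDiff n
  have hc := moll_hasCompactSupport n
  have hG' : ContDiff ℝ (⊤ : ℕ∞) (fderiv ℝ (moll n)) := hG.fderiv_right (by exact_mod_cast le_rfl)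
  have hG'' : ContDiff ℝ (⊤ : ℕ∞) (fderiv ℝ (fderiv ℝ (moll n))) :=
    hG'.fderiv_right (by exact_mod_cast le_rfl)
  have hi1 : Integrable fun z => ‖fderiv ℝ (moll n) z‖ :=
    (hG'.continuous.integrable_of_hasCompactSupport (hc.fderiv ℝ)).norm
  have hi2 : Integrable fun z => ‖fderiv ℝ (fderiv ℝ (moll n)) z‖ :=
    (hG''.continuous.integrable_of_hasCompactSupport ((hc.fderiv ℝ).fderiv ℝ)).norm
  obtain ⟨C₁, hC₁⟩ : ∃ C, C = ∫ z, ‖fderiv ℝ (moll n) z‖ := ⟨_, rfl⟩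
  obtain ⟨C₂, hC₂⟩ : ∃ C, C = ∫ z, ‖fderiv ℝ (fderiv ℝ (moll n)) z‖ := ⟨_, rfl⟩
  have hC₁0 : 0 ≤ C₁ := by rw [hC₁]; exact integral_nonneg fun z => norm_nonneg _
  have hC₂0 : 0 ≤ C₂ := by rw [hC₂]; positivity
  have hG1 : ContDiff ℝ 1 (moll n) := hG.of_le (by exact_mod_cast le_top)
  refine ⟨C₁ + C₂ + 1, by positivity, fun e he φ hφ M hM r hr x => ?_⟩
  have hM0 : 0 ≤ M := (abs_nonneg _).trans (hM x)
  have hφ1 : ContDiff ℝ 1 φ := hφ.of_le (by exact_mod_cast le_top)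
  have hdφ1 : ContDiff ℝ 1 (dd n e φ) := (dd_contDiff hφ e).of_le (by exact_mod_cast le_top)
  have hdG1 : ContDiff ℝ 1 (dd n e (moll n)) := (dd_contDiff hG e).of_le (by exact_mod_cast le_top)
  have hdc : HasCompactSupport (dd n e (moll n)) := hc.fderiv_apply ℝ e
  constructor
  · have h := integral_dd_mul hφ1 hG1 hc e x r
    have hb := abs_integral_mul_le (φ := fun z => φ (x + r • z)) (fun z => hM _) hi1
      (abs_dd_le he (moll n))
    rw [← hC₁] at hb
    rw [le_div_iff₀ hr]
    calc |avg n r (dd n e φ) x| * r = |r * avg n r (dd n e φ) x| := by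
          rw [abs_mul, abs_of_pos hr, mul_comm]
      _ ≤ M * C₁ := by rw [avg, h, abs_neg]; exact hb
      _ ≤ (C₁ + C₂ + 1) * M := by nlinarith
  · have h := integral_dd_mul hdφ1 hG1 hc e x r
    have h2 := integral_dd_mul hφ1 hdG1 hdc e x r
    have hb := abs_integral_mul_le (φ := fun z => φ (x + r • z)) (fun z => hM _) hi2
      (abs_dd_dd_le hG he he)
    rw [← hC₂] at hb
    rw [le_div_iff₀ (by positivity)]
    calc |avg n r (dd n e (dd n e φ)) x| * r ^ 2
        = |r * (r * avg n r (dd n e (dd n e φ)) x)| := by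
          rw [abs_mul, abs_mul, abs_of_pos hr]; ring
      _ ≤ M * C₂ := by rw [avg, h, mul_neg, h2, neg_neg]; exact hb
      _ ≤ (C₁ + C₂ + 1) * M := by nlinarith

lemma sq_le_mul_of_forall_le {X Γ K : ℝ} (hX : 0 ≤ X) (hΓ : 0 ≤ Γ) (hK : 0 < K)
    (h : ∀ t : ℝ, 0 < t → X ≤ t * Γ / 2 + K / (2 * t)) : X ^ 2 ≤ K * Γ := by
  rcases hX.eq_or_lt with h0 | h0
  · rw [← h0]; nlinarith [mul_nonneg hK.le hΓ]
  · have h1 := h (K / X) (by positivity)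
    have h2 : K / X * Γ / 2 + K / (2 * (K / X)) = K * Γ / (2 * X) + X / 2 := by
      field_simp
    rw [h2] at h1
    have h3 : X / 2 ≤ K * Γ / (2 * X) := by linarith
    rw [le_div_iff₀ (by positivity)] at h3
    nlinarith

lemma exists_avg_dd_sq_le (n : ℕ) : ∃ C : ℝ, 0 < C ∧ ∀ (e : En n), ‖e‖ = 1 →
    ∀ φ : En n → ℝ, ContDiff ℝ (⊤ : ℕ∞) φ → ∀ (r : ℝ), 0 < r → ∀ x,
    (r * avg n r (dd n e φ) x) ^ 2 ≤ C * avg n r (fun y => (φ y - φ x) ^ 2) x := by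
  set V := ∫ y, cutoff n y ^ 2 with hV
  have hVpos : 0 < V := integral_cutoff_sq_pos n
  set K := ∫ z, 4 * ‖fderiv ℝ (cutoff n) z‖ ^ 2 / V
  have hK : 0 ≤ K := integral_nonneg fun _ => by positivity
  have hχ := cutoff_contDiff n
  have hχ1 : ContDiff ℝ 1 (cutoff n) := hχ.of_le (by exact_mod_cast le_top)
  have hG1 : ContDiff ℝ 1 (moll n) := (moll_contDiff n).of_le (by exact_mod_cast le_top)
  have hint : Integrable fun z => 4 * ‖fderiv ℝ (cutoff n) z‖ ^ 2 / V := by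
    have hcont : Continuous (fderiv ℝ (cutoff n)) := hχ1.continuous_fderiv (by simp)
    refine Continuous.integrable_of_hasCompactSupport (by fun_prop) ?_
    exact (((cutoff_hasCompactSupport n).fderiv ℝ).comp_left
      (g := fun L => 4 * ‖L‖ ^ 2 / V) (by simp))
  refine ⟨K + 1, by positivity, fun e he φ hφ r hr x => ?_⟩
  have hφ1 : ContDiff ℝ 1 φ := hφ.of_le (by exact_mod_cast le_top)
  have hddeq : dd n e (fun y => φ y - φ x) = dd n e φ := by
    funext y; simp [dd, fderiv_sub_const]
  have hibp := integral_dd_mul (hφ1.sub (contDiff_const (c := φ x))) hG1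
    (moll_hasCompactSupport n) e x r
  rw [hddeq] at hibp
  have hddG : ∀ z, dd n e (moll n) z = 2 * cutoff n z * dd n e (cutoff n) z / V := by
    intro z
    have h0 : HasFDerivAt (cutoff n) (fderiv ℝ (cutoff n) z) z :=
      (hχ1.differentiable (by simp) z).hasFDerivAt
    have h1 := (h0.pow 2).mul_const V⁻¹
    have h2 : HasFDerivAt (moll n) _ z := h1
    rw [dd, h2.fderiv]
    simp [dd]
    ring
  have hcφ : Continuous fun z : En n => (φ (x + r • z) - φ x) ^ 2 := by
    have := hφ1.continuous
    fun_prop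
  have hΓint : Integrable fun z : En n => (φ (x + r • z) - φ x) ^ 2 * moll n z :=
    integrable_mul_moll hcφ
  rw [← sq_abs]
  refine sq_le_mul_of_forall_le (abs_nonneg _)
    (integral_nonneg fun z => mul_nonneg (sq_nonneg _) (moll_nonneg n z)) (by positivity) fun t ht => ?_
  rw [avg, hibp, abs_neg]
  have hb : |∫ z, (φ (x + r • z) - φ x) * dd n e (moll n) z| ≤
      ∫ z, (t / 2 * ((φ (x + r • z) - φ x) ^ 2 * moll n z)
        + (2 * t)⁻¹ * (4 * ‖fderiv ℝ (cutoff n) z‖ ^ 2 / V)) := by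
    rw [← Real.norm_eq_abs]
    refine norm_integral_le_of_norm_le ((hΓint.const_mul _).add (hint.const_mul _))
      (.of_forall fun z => ?_)
    rw [hddG, Real.norm_eq_abs, moll, ← hV]
    have hd : |dd n e (cutoff n) z| ≤ ‖fderiv ℝ (cutoff n) z‖ := abs_dd_le he _ z
    have e1 : |(φ (x + r • z) - φ x) * (2 * cutoff n z * dd n e (cutoff n) z / V)|
        = 2 * (|φ (x + r • z) - φ x| * |cutoff n z|) * |dd n e (cutoff n) z| / V := by
      simp only [abs_mul, abs_div, abs_of_pos hVpos, abs_two]; ring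
    have e2 : (φ (x + r • z) - φ x) ^ 2 * (cutoff n z ^ 2 / V)
        = (|φ (x + r • z) - φ x| * |cutoff n z|) ^ 2 / V := by
      rw [mul_pow, sq_abs, sq_abs]; ring
    rw [e1, e2]
    set Y := |φ (x + r • z) - φ x| * |cutoff n z|
    have hY : 0 ≤ Y := by positivity
    set D := ‖fderiv ℝ (cutoff n) z‖
    have e3 : t / 2 * (Y ^ 2 / V) + (2 * t)⁻¹ * (4 * D ^ 2 / V) - 2 * Y * D / V
        = (t * Y - 2 * D) ^ 2 / (2 * t * V) := by field_simp; ring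
    have e4 : 0 ≤ (t * Y - 2 * D) ^ 2 / (2 * t * V) := by positivity
    have e5 : 2 * Y * |dd n e (cutoff n) z| / V ≤ 2 * Y * D / V := by gcongr
    linarith
  refine hb.trans ?_
  rw [integral_add (hΓint.const_mul _) (hint.const_mul _), integral_const_mul, integral_const_mul]
  have h6 : (2 * t)⁻¹ * K ≤ (K + 1) / (2 * t) := by
    rw [inv_mul_eq_div]; gcongr; linarith
  have h7 : t / 2 * ∫ z, (φ (x + r • z) - φ x) ^ 2 * moll n z
      = t * avg n r (fun y => (φ y - φ x) ^ 2) x / 2 := by rw [avg]; ring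
  rw [h7]
  linarith

/-! ### Cutoff and barrier in a ball -/

/-- A quadratic cutoff supported in the ball of radius `R` around `c`. -/
def quadCut (n : ℕ) (c : En n) (R : ℝ) (y : En n) : ℝ := max 0 (1 - ‖y - c‖ ^ 2 / R ^ 2)

/-- A quadratic barrier in the ball of radius `2 * R` around `c`. -/
def quadBar (n : ℕ) (c : En n) (R : ℝ) (y : En n) : ℝ := max 0 (4 - ‖y - c‖ ^ 2 / R ^ 2)

lemma quadCut_continuous (n : ℕ) (c : En n) (R : ℝ) : Continuous (quadCut n c R) := by
  unfold quadCut; fun_prop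

lemma quadBar_continuous (n : ℕ) (c : En n) (R : ℝ) : Continuous (quadBar n c R) := by
  unfold quadBar; fun_prop

lemma norm_add_smul_sub_sq {n : ℕ} (x c z : En n) (r : ℝ) :
    ‖x + r • z - c‖ ^ 2 = ‖x - c‖ ^ 2 + 2 * r * inner ℝ (x - c) z + r ^ 2 * ‖z‖ ^ 2 := by
  rw [add_sub_right_comm, norm_add_sq_real, real_inner_smul_right, norm_smul, mul_pow,
    Real.norm_eq_abs, sq_abs]
  ring

lemma pow_four_le_of_small {a ε τ : ℝ} (ha1 : a ≤ 1) (hε : 0 ≤ ε) (h6 : 6 * ε ≤ a)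
    (hτ : |τ| ≤ 2 * ε) :
    a ^ 4 ≤ (a - τ - ε ^ 2) ^ 2 * (a ^ 2 + 2 * a * τ + 100 * ε ^ 2) := by
  obtain ⟨h1, h2⟩ := abs_le.1 hτ
  have ha : 0 ≤ a := by linarith
  set δ := τ + ε ^ 2
  have hε1 : ε ^ 2 ≤ ε / 6 := by nlinarith
  have hδ : |δ| ≤ 13 / 6 * ε := abs_le.2 ⟨by simp only [δ]; nlinarith, by simp only [δ]; linarith⟩
  have e1 : |δ * τ| ≤ 13 / 3 * ε ^ 2 := by
    rw [abs_mul]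
    calc |δ| * |τ| ≤ (13 / 6 * ε) * (2 * ε) := by gcongr
      _ = _ := by ring
  have e2 : a * δ ≤ a * (13 / 6 * ε) := by gcongr; exact (abs_le.1 hδ).2
  have e3 : a * (13 / 6 * ε) ≤ 13 / 36 * a ^ 2 := by nlinarith
  have e4 : a ^ 2 * (δ * τ) ≤ a ^ 2 * (13 / 3 * ε ^ 2) :=
    mul_le_mul_of_nonneg_left (abs_le.1 e1).2 (sq_nonneg a)
  have e5 : a * δ * ε ^ 2 ≤ 13 / 36 * a ^ 2 * ε ^ 2 :=
    mul_le_mul_of_nonneg_right (e2.trans e3) (sq_nonneg ε)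
  have e6 : a ^ 3 * ε ^ 2 ≤ a ^ 2 * ε ^ 2 := by
    gcongr 1
    nlinarith [sq_nonneg a]
  have e7 : 0 ≤ a ^ 2 + 2 * a * τ + 100 * ε ^ 2 := by nlinarith
  have e8 : 0 ≤ δ ^ 2 * (a ^ 2 + 2 * a * τ + 100 * ε ^ 2) := by positivity
  have e9 : 0 ≤ a ^ 2 * ε ^ 2 := by positivity
  have e10 : (a - τ - ε ^ 2) ^ 2 * (a ^ 2 + 2 * a * τ + 100 * ε ^ 2)
      = a ^ 4 - 2 * (a ^ 3 * ε ^ 2) + 100 * (a ^ 2 * ε ^ 2) - 4 * (a ^ 2 * (δ * τ))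
        - 200 * (a * δ * ε ^ 2) + δ ^ 2 * (a ^ 2 + 2 * a * τ + 100 * ε ^ 2) := by
    simp only [δ]; ring
  rw [e10]
  nlinarith

lemma two_mul_le_of_pow_four_le {a h Q m q w : ℝ} (hQ : 0 < Q) (hm : 0 ≤ m)
    (hwq : w ≤ q) (hh : a ^ 4 ≤ h ^ 2 * Q) :
    2 * a ^ 2 * m * w - m ^ 2 * Q ≤ h ^ 2 * q ^ 2 := by
  have h1 : 2 * a ^ 2 * m * w ≤ 2 * a ^ 2 * m * q := by gcongr
  have h2 : 0 ≤ (h ^ 2 * q ^ 2 + m ^ 2 * Q - 2 * a ^ 2 * m * q) * Q := by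
    have h3 : a ^ 4 * q ^ 2 ≤ h ^ 2 * Q * q ^ 2 := by gcongr
    nlinarith [sq_nonneg (a ^ 2 * q - m * Q)]
  have h3 := nonneg_of_mul_nonneg_left h2 hQ
  linarith

lemma quadCut_eq {n : ℕ} {c x : En n} {R : ℝ} (hR : 0 < R) (hx : ‖x - c‖ ≤ R) :
    quadCut n c R x = 1 - ‖x - c‖ ^ 2 / R ^ 2 := by
  refine max_eq_right (sub_nonneg.2 ?_)
  rw [div_le_one (by positivity)]
  gcongr

lemma quadCut_nonneg {n : ℕ} (c : En n) (R : ℝ) (x : En n) : 0 ≤ quadCut n c R x := le_max_left _ _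

lemma quadCut_le_one {n : ℕ} (c : En n) (R : ℝ) (x : En n) : quadCut n c R x ≤ 1 :=
  max_le zero_le_one (by linarith [show 0 ≤ ‖x - c‖ ^ 2 / R ^ 2 by positivity])

lemma cut_average_le {n : ℕ} {c x : En n} {R r p : ℝ} (hR : 0 < R) (hr : 0 < r)
    (hx : ‖x - c‖ ≤ R) {W : En n → ℝ} (hW : Continuous W) (hp : 0 ≤ p) :
    2 * quadCut n c R x ^ 2 * p * avg n r W x - quadCut n c R x ^ 2 * p ^ 2
      - avg n r (fun y => quadCut n c R y ^ 2 * max 0 (W y) ^ 2) x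
      ≤ 100 * (avg n r W x) ^ 2 * (r / R) ^ 2 := by
  set a := quadCut n c R x with ha
  have ha0 : 0 ≤ a := quadCut_nonneg c R x
  have ha1 : a ≤ 1 := quadCut_le_one c R x
  set m := avg n r W x with hm
  set ε := r / R with hε
  have hε0 : 0 < ε := by positivity
  have hcη := quadCut_continuous n c R
  have hA : 0 ≤ avg n r (fun y => quadCut n c R y ^ 2 * max 0 (W y) ^ 2) x :=
    integral_nonneg fun z => mul_nonneg (by positivity) (moll_nonneg n z)
  rcases le_or_gt m 0 with hm0 | hm0
  · have : 2 * a ^ 2 * p * m ≤ 0 := mul_nonpos_of_nonneg_of_nonpos (by positivity) hm0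
    have : 0 ≤ a ^ 2 * p ^ 2 := by positivity
    have : 0 ≤ 100 * m ^ 2 * ε ^ 2 := by positivity
    linarith
  rcases lt_or_ge a (6 * ε) with h6 | h6
  · have h1 : a ^ 2 * m ^ 2 ≤ (6 * ε) ^ 2 * m ^ 2 := by gcongr
    have h2 : 0 ≤ a ^ 2 * (p - m) ^ 2 := by positivity
    have h3 : 0 ≤ m ^ 2 * ε ^ 2 := by positivity
    nlinarith
  · have key : ∀ z : En n, ‖z‖ < 1 → 2 * a ^ 2 * m * W (x + r • z)
        - m ^ 2 * ((a ^ 2 + 100 * ε ^ 2) + 4 * a * r / R ^ 2 * inner ℝ (x - c) z) ≤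
        quadCut n c R (x + r • z) ^ 2 * max 0 (W (x + r • z)) ^ 2 := by
      intro z hz
      set τ := 2 * r / R ^ 2 * inner ℝ (x - c) z with hτ
      have hin : |inner ℝ (x - c) z| ≤ R := by
        refine (abs_real_inner_le_norm _ _).trans ?_
        nlinarith [norm_nonneg z, norm_nonneg (x - c)]
      have hτ2 : |τ| ≤ 2 * ε := by
        rw [hτ, abs_mul, abs_of_pos (by positivity)]
        calc 2 * r / R ^ 2 * |inner ℝ (x - c) z| ≤ 2 * r / R ^ 2 * R := by gcongr
          _ = 2 * ε := by rw [hε]; field_simp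
      have hp4 := pow_four_le_of_small ha1 hε0.le h6 hτ2
      have hτ' := abs_le.1 hτ2
      have hpos : 0 ≤ a - τ - ε ^ 2 := by nlinarith
      have hcut : a - τ - ε ^ 2 ≤ quadCut n c R (x + r • z) := by
        refine le_trans ?_ (le_max_right _ _)
        rw [norm_add_smul_sub_sq, ha, quadCut_eq hR hx, hτ, hε]
        have : r ^ 2 * ‖z‖ ^ 2 / R ^ 2 ≤ (r / R) ^ 2 := by
          rw [div_pow]
          gcongr
          exact mul_le_of_le_one_right (sq_nonneg r) (by nlinarith [norm_nonneg z])
        have e : (‖x - c‖ ^ 2 + 2 * r * inner ℝ (x - c) z + r ^ 2 * ‖z‖ ^ 2) / R ^ 2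
          = ‖x - c‖ ^ 2 / R ^ 2 + 2 * r / R ^ 2 * inner ℝ (x - c) z + r ^ 2 * ‖z‖ ^ 2 / R ^ 2 := by
          ring
        rw [e]
        linarith
      have hQ : 0 < a ^ 2 + 2 * a * τ + 100 * ε ^ 2 := by
        have : 0 < ε ^ 2 := by positivity
        nlinarith
      have := two_mul_le_of_pow_four_le (a := a) (h := quadCut n c R (x + r • z)) hQ hm0.le
        (le_max_right 0 (W (x + r • z)))
        (hp4.trans (mul_le_mul_of_nonneg_right (pow_le_pow_left₀ hpos hcut 2) hQ.le))
      refine le_trans (le_of_eq ?_) this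
      rw [hτ]; ring
    have hint := integral_mul_moll_mono (by fun_prop) (by fun_prop) key
    have e1 : ∫ z, (2 * a ^ 2 * m * W (x + r • z)
        - m ^ 2 * ((a ^ 2 + 100 * ε ^ 2) + 4 * a * r / R ^ 2 * inner ℝ (x - c) z)) * moll n z
        = 2 * a ^ 2 * m * m - m ^ 2 * (a ^ 2 + 100 * ε ^ 2) := by
      have e2 : ∀ z, (2 * a ^ 2 * m * W (x + r • z)
        - m ^ 2 * ((a ^ 2 + 100 * ε ^ 2) + 4 * a * r / R ^ 2 * inner ℝ (x - c) z)) * moll n z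
        = (2 * a ^ 2 * m * (W (x + r • z) * moll n z) - m ^ 2 * (a ^ 2 + 100 * ε ^ 2) * moll n z)
          - m ^ 2 * (4 * a * r / R ^ 2) * (inner ℝ (x - c) z * moll n z) := fun z => by ring
      have i1 := (integrable_avg hW r x).const_mul (2 * a ^ 2 * m)
      have i2 := (integrable_mul_moll (n := n) (ψ := fun _ => m ^ 2 * (a ^ 2 + 100 * ε ^ 2))
        continuous_const)
      have i3 := (integrable_mul_moll (n := n) (ψ := fun z => inner ℝ (x - c) z)
        (by fun_prop)).const_mul (m ^ 2 * (4 * a * r / R ^ 2))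
      have i12 : Integrable (fun z => 2 * a ^ 2 * m * (W (x + r • z) * moll n z)
          - m ^ 2 * (a ^ 2 + 100 * ε ^ 2) * moll n z) := i1.sub i2
      simp only [e2]
      rw [integral_sub i12 i3, integral_sub i1 i2, integral_const_mul, integral_const_mul,
        integral_const_mul, integral_inner_mul_moll, integral_moll, hm, avg]
      ring
    rw [e1] at hint
    have h2 : 0 ≤ a ^ 2 * (p - m) ^ 2 := by positivity
    have : avg n r (fun y => quadCut n c R y ^ 2 * max 0 (W y) ^ 2) x
      = ∫ z, quadCut n c R (x + r • z) ^ 2 * max 0 (W (x + r • z)) ^ 2 * moll n z := rfl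
    nlinarith

/-- The second moment of the mollifier. -/
def moment (n : ℕ) : ℝ := ∫ z, ‖z‖ ^ 2 * moll n z

lemma moment_pos {n : ℕ} (hn : 0 < n) : 0 < moment n := by
  have hi : 0 < (1 / 2 : ℝ) := by norm_num
  set z₀ : En n := EuclideanSpace.single ⟨0, hn⟩ (1 / 2)
  have hz₀ : ‖z₀‖ = 1 / 2 := by simp [z₀]
  refine Continuous.integral_pos_of_hasCompactSupport_nonneg_nonzero (x := z₀)
    ((continuous_norm.pow 2).mul (moll_continuous n)) (moll_hasCompactSupport n).mul_left
    (fun z => mul_nonneg (by positivity) (moll_nonneg n z)) ?_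
  have h1 : 0 < cutoff n z₀ := Real.smoothTransition.pos_of_pos (by rw [hz₀]; norm_num)
  have h2 : 0 < moll n z₀ := div_pos (by positivity) (integral_cutoff_sq_pos n)
  rw [hz₀]
  positivity

lemma moment_le_one (n : ℕ) : moment n ≤ 1 := by
  have := integral_mul_moll_mono (n := n) (ψ₁ := fun z => ‖z‖ ^ 2) (ψ₂ := fun _ => 1)
    (by fun_prop) (by fun_prop) (fun z hz => by nlinarith [norm_nonneg z])
  rwa [integral_const_mul_moll] at this

lemma quadBar_le_four {n : ℕ} (c : En n) (R : ℝ) (x : En n) : quadBar n c R x ≤ 4 :=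
  max_le (by norm_num) (by linarith [show 0 ≤ ‖x - c‖ ^ 2 / R ^ 2 by positivity])

lemma quadBar_nonneg {n : ℕ} (c : En n) (R : ℝ) (x : En n) : 0 ≤ quadBar n c R x := le_max_left _ _

lemma le_quadBar_sub_avg {n : ℕ} {c x : En n} {R r : ℝ} (hR : 0 < R) (hr : 0 < r)
    (hx : ‖x - c‖ ≤ R) :
    moment n * min ((r / R) ^ 2) 1 ≤ quadBar n c R x - avg n r (quadBar n c R) x := by
  have hcb := quadBar_continuous n c R
  have hsymm : avg n r (quadBar n c R) x =
      ∫ z, (quadBar n c R (x + r • z) + quadBar n c R (x + r • (-z))) / 2 * moll n z := by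
    have h := integral_mul_moll_neg (n := n) (fun z => quadBar n c R (x + r • z))
    have i1 := integrable_mul_moll (n := n) (ψ := fun z => quadBar n c R (x + r • z)) (by fun_prop)
    have i2 := integrable_mul_moll (n := n) (ψ := fun z => quadBar n c R (x + r • (-z)))
      (by fun_prop)
    have e : ∀ z, (quadBar n c R (x + r • z) + quadBar n c R (x + r • (-z))) / 2 * moll n z
      = (1 / 2) * (quadBar n c R (x + r • z) * moll n z)
        + (1 / 2) * (quadBar n c R (x + r • (-z)) * moll n z) := fun z => by ring
    simp only [e]
    rw [integral_add (i1.const_mul _) (i2.const_mul _), integral_const_mul, integral_const_mul, h,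
      avg]
    ring
  have hb : quadBar n c R x = 4 - ‖x - c‖ ^ 2 / R ^ 2 ∧ ‖x - c‖ ^ 2 / R ^ 2 ≤ 1 := by
    have h1 : ‖x - c‖ ^ 2 / R ^ 2 ≤ 1 := by
      rw [div_le_one (by positivity)]
      gcongr
    exact ⟨max_eq_right (by linarith), h1⟩
  have key : ∀ z : En n, ‖z‖ < 1 →
      (quadBar n c R (x + r • z) + quadBar n c R (x + r • (-z))) / 2 ≤
      quadBar n c R x - min ((r / R) ^ 2) 1 * ‖z‖ ^ 2 := by
    intro z hz
    have hz2 : ‖z‖ ^ 2 ≤ 1 := by nlinarith [norm_nonneg z]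
    have hmin0 : 0 ≤ min ((r / R) ^ 2) 1 := le_min (by positivity) zero_le_one
    have hm1 : min ((r / R) ^ 2) 1 * ‖z‖ ^ 2 ≤ 1 := by
      nlinarith [min_le_right ((r / R) ^ 2) 1, sq_nonneg ‖z‖]
    have hm2 : min ((r / R) ^ 2) 1 * ‖z‖ ^ 2 ≤ r ^ 2 * ‖z‖ ^ 2 / R ^ 2 := by
      calc min ((r / R) ^ 2) 1 * ‖z‖ ^ 2 ≤ (r / R) ^ 2 * ‖z‖ ^ 2 := by
            gcongr; exact min_le_left _ _
        _ = _ := by ring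
    have f1 := quadBar_le_four c R (x + r • z)
    have f2 := quadBar_le_four c R (x + r • (-z))
    have e1 : ‖x + r • z - c‖ ^ 2 / R ^ 2 = ‖x - c‖ ^ 2 / R ^ 2 +
        2 * r * inner ℝ (x - c) z / R ^ 2 + r ^ 2 * ‖z‖ ^ 2 / R ^ 2 := by
      rw [norm_add_smul_sub_sq]; ring
    have e2 : ‖x + r • (-z) - c‖ ^ 2 / R ^ 2 = ‖x - c‖ ^ 2 / R ^ 2 -
        2 * r * inner ℝ (x - c) z / R ^ 2 + r ^ 2 * ‖z‖ ^ 2 / R ^ 2 := by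
      rw [norm_add_smul_sub_sq, inner_neg_right, norm_neg]; ring
    rw [hb.1]
    rcases le_total 0 (4 - ‖x + r • z - c‖ ^ 2 / R ^ 2) with h1 | h1
    · rcases le_total 0 (4 - ‖x + r • (-z) - c‖ ^ 2 / R ^ 2) with h2 | h2
      · have g1 : quadBar n c R (x + r • z) = _ := max_eq_right h1
        have g2 : quadBar n c R (x + r • (-z)) = _ := max_eq_right h2
        rw [g1, g2, e1, e2]
        linarith
      · have g2 : quadBar n c R (x + r • (-z)) = _ := max_eq_left h2
        rw [g2]
        linarith [hb.2]
    · have g1 : quadBar n c R (x + r • z) = _ := max_eq_left h1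
      rw [g1]
      linarith [hb.2]
  have hint := integral_mul_moll_mono (by fun_prop) (by fun_prop) key
  rw [hsymm]
  have e3 : ∫ z, (quadBar n c R x - min ((r / R) ^ 2) 1 * ‖z‖ ^ 2) * moll n z
      = quadBar n c R x - min ((r / R) ^ 2) 1 * moment n := by
    have i1 := integrable_mul_moll (n := n) (ψ := fun _ => quadBar n c R x) continuous_const
    have i2 := (integrable_mul_moll (n := n) (ψ := fun z => ‖z‖ ^ 2) (by fun_prop)).const_mul
      (min ((r / R) ^ 2) 1)
    have e : ∀ z, (quadBar n c R x - min ((r / R) ^ 2) 1 * ‖z‖ ^ 2) * moll n z =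
      quadBar n c R x * moll n z - min ((r / R) ^ 2) 1 * (‖z‖ ^ 2 * moll n z) := fun z => by ring
    simp only [e]
    rw [integral_sub i1 i2, integral_const_mul_moll, integral_const_mul, moment]
  rw [e3] at hint
  linarith

/-! ### The Bernstein inequality at a fixed scale -/

lemma avg_sq_sub {n : ℕ} {U : En n → ℝ} (hU : Continuous U) (r : ℝ) (x : En n) :
    avg n r (fun y => (U y - U x) ^ 2) x
      = avg n r (fun y => U y ^ 2) x - 2 * U x * avg n r U x + U x ^ 2 := by
  have i1 : Integrable (fun z => U (x + r • z) ^ 2 * moll n z) :=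
    integrable_mul_moll (by fun_prop)
  have i2 := (integrable_avg hU r x).const_mul (2 * U x)
  have i3 : Integrable (fun z => U x ^ 2 * moll n z) := integrable_mul_moll continuous_const
  have i12 : Integrable (fun z => U (x + r • z) ^ 2 * moll n z
    - 2 * U x * (U (x + r • z) * moll n z)) := i1.sub i2
  have e : ∀ z, (U (x + r • z) - U x) ^ 2 * moll n z = U (x + r • z) ^ 2 * moll n z
    - 2 * U x * (U (x + r • z) * moll n z) + U x ^ 2 * moll n z := fun z => by ring
  simp only [avg, e]
  rw [integral_add i12 i3, integral_sub i1 i2, integral_const_mul, integral_const_mul,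
    integral_moll, mul_one]

lemma exists_bernstein_scale (n : ℕ) : ∃ σ : ℝ, 0 < σ ∧ ∀ e : En n, ‖e‖ = 1 →
    ∀ U : En n → ℝ, ContDiff ℝ (⊤ : ℕ∞) U → ∀ (c x : En n) (R M B : ℝ), 0 < R →
    ‖x - c‖ ≤ R → 0 ≤ M →
    (∀ y, ‖y - c‖ < 2 * R →
      quadCut n c R y ^ 2 * max 0 (dd n e U y) ^ 2 + σ / R ^ 2 * U y ^ 2 - M * quadBar n c R y ≤
      quadCut n c R x ^ 2 * max 0 (dd n e U x) ^ 2 + σ / R ^ 2 * U x ^ 2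
        - M * quadBar n c R x) →
    M * quadBar n c R x ≤ quadCut n c R x ^ 2 * max 0 (dd n e U x) ^ 2 + σ / R ^ 2 * U x ^ 2 →
    (∀ r, R < r → |avg n r U x| ≤ B ∧ |avg n r (dd n e U) x| ≤ B / R) →
    ∀ r, 0 < r → (M * moment n - (1 + σ) * (B / R) ^ 2) * min ((r / R) ^ 2) 1 ≤
      2 * (quadCut n c R x ^ 2 * max 0 (dd n e U x)) * (dd n e U x - avg n r (dd n e U) x)
        + 2 * (σ / R ^ 2) * U x * (U x - avg n r U x) := by
  obtain ⟨C, hC, hCb⟩ := exists_avg_dd_sq_le n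
  refine ⟨100 * C, by positivity, ?_⟩
  intro e he U hU c x R M B hR hx hM ha hb hB r hr
  have hW : ContDiff ℝ (⊤ : ℕ∞) (dd n e U) := dd_contDiff hU e
  have hcU := hU.continuous
  have hcW := hW.continuous
  have hcη := quadCut_continuous n c R
  have hcb := quadBar_continuous n c R
  have hbar := le_quadBar_sub_avg hR hr hx
  set W := dd n e U with hWdef
  set σ := 100 * C / R ^ 2 with hσ
  have hσ0 : 0 < σ := by positivity
  set a := quadCut n c R x with ha'
  set p := max 0 (W x) with hp
  have hp0 : 0 ≤ p := le_max_left _ _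
  have hpW : p * W x = p ^ 2 := by
    rcases le_total (W x) 0 with h | h
    · rw [hp, max_eq_left h]; ring
    · rw [hp, max_eq_right h]; ring
  set m := avg n r W x with hm
  set k := avg n r U x with hk
  have hpW' : 2 * (a ^ 2 * p) * (W x - m) = 2 * a ^ 2 * p ^ 2 - 2 * a ^ 2 * p * m := by
    linear_combination 2 * a ^ 2 * hpW
  rw [hpW']
  rcases le_or_gt r R with hrR | hrR
  · have hr1 : r / R ≤ 1 := (div_le_one hR).2 hrR
    have hr2 : (r / R) ^ 2 ≤ 1 := pow_le_one₀ (by positivity) hr1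
    rw [min_eq_left hr2] at hbar ⊢
    have hcut := cut_average_le hR hr hx hcW hp0
    have hgrad := hCb e he U hU r hr x
    rw [avg_sq_sub hcU] at hgrad
    have key := integral_mul_moll_mono (n := n)
      (ψ₁ := fun z => quadCut n c R (x + r • z) ^ 2 * max 0 (W (x + r • z)) ^ 2
        + σ * U (x + r • z) ^ 2 - M * quadBar n c R (x + r • z))
      (ψ₂ := fun _ => a ^ 2 * p ^ 2 + σ * U x ^ 2 - M * quadBar n c R x)
      (by fun_prop) (by fun_prop) (fun z hz => ha _ (by
        calc ‖x + r • z - c‖ = ‖(x - c) + r • z‖ := by rw [add_sub_right_comm]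
          _ ≤ ‖x - c‖ + ‖r • z‖ := norm_add_le _ _
          _ < R + R := by
            refine add_lt_add_of_le_of_lt hx ?_
            rw [norm_smul, Real.norm_eq_abs, abs_of_pos hr]
            nlinarith [norm_nonneg z]
          _ = 2 * R := by ring))
    rw [integral_const_mul_moll] at key
    have i1 : Integrable (fun z => quadCut n c R (x + r • z) ^ 2 * max 0 (W (x + r • z)) ^ 2
      * moll n z) := integrable_mul_moll (ψ := fun z => quadCut n c R (x + r • z) ^ 2
        * max 0 (W (x + r • z)) ^ 2) (by fun_prop)
    have i2 : Integrable (fun z => σ * (U (x + r • z) ^ 2 * moll n z)) :=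
      (integrable_mul_moll (ψ := fun z => U (x + r • z) ^ 2) (by fun_prop)).const_mul σ
    have i3 : Integrable (fun z => M * (quadBar n c R (x + r • z) * moll n z)) :=
      (integrable_mul_moll (ψ := fun z => quadBar n c R (x + r • z)) (by fun_prop)).const_mul M
    have i12 : Integrable (fun z => quadCut n c R (x + r • z) ^ 2 * max 0 (W (x + r • z)) ^ 2
      * moll n z + σ * (U (x + r • z) ^ 2 * moll n z)) := i1.add i2
    have e1 : ∀ z, (quadCut n c R (x + r • z) ^ 2 * max 0 (W (x + r • z)) ^ 2
        + σ * U (x + r • z) ^ 2 - M * quadBar n c R (x + r • z)) * moll n z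
        = quadCut n c R (x + r • z) ^ 2 * max 0 (W (x + r • z)) ^ 2 * moll n z
          + σ * (U (x + r • z) ^ 2 * moll n z) - M * (quadBar n c R (x + r • z) * moll n z) :=
      fun z => by ring
    simp only [e1] at key
    rw [integral_sub i12 i3, integral_add i1 i2, integral_const_mul, integral_const_mul] at key
    have hX : ∫ z, quadCut n c R (x + r • z) ^ 2 * max 0 (W (x + r • z)) ^ 2 * moll n z
      = avg n r (fun y => quadCut n c R y ^ 2 * max 0 (W y) ^ 2) x := rfl
    have hY : ∫ z, U (x + r • z) ^ 2 * moll n z = avg n r (fun y => U y ^ 2) x := rfl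
    have hZ : ∫ z, quadBar n c R (x + r • z) * moll n z = avg n r (quadBar n c R) x := rfl
    rw [hX, hY, hZ] at key
    have h1 : M * (moment n * (r / R) ^ 2) ≤ M * (quadBar n c R x - avg n r (quadBar n c R) x) :=
      mul_le_mul_of_nonneg_left hbar hM
    have h2 : 100 * m ^ 2 * (r / R) ^ 2 ≤ σ *
        (avg n r (fun y => U y ^ 2) x - 2 * U x * k + U x ^ 2) := by
      calc 100 * m ^ 2 * (r / R) ^ 2 = 100 / R ^ 2 * (r * m) ^ 2 := by ring
        _ ≤ 100 / R ^ 2 * (C * (avg n r (fun y => U y ^ 2) x - 2 * U x * k + U x ^ 2)) := by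
          gcongr
        _ = _ := by rw [hσ]; ring
    have h3 : 0 ≤ (1 + 100 * C) * (B / R) ^ 2 * (r / R) ^ 2 := by positivity
    linarith
  · have hr1 : 1 ≤ r / R := (one_le_div hR).2 hrR.le
    have hr2 : 1 ≤ (r / R) ^ 2 := one_le_pow₀ hr1
    rw [min_eq_right hr2] at hbar ⊢
    obtain ⟨hB1, hB2⟩ := hB r hrR
    have h0 : 0 ≤ avg n r (quadBar n c R) x :=
      integral_nonneg fun z => mul_nonneg (quadBar_nonneg _ _ _) (moll_nonneg n z)
    have h1 : M * (moment n * 1) ≤ M * quadBar n c R x :=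
      mul_le_mul_of_nonneg_left (by linarith) hM
    have h2 : k ^ 2 ≤ B ^ 2 := sq_le_sq' (abs_le.1 hB1).1 (abs_le.1 hB1).2
    have h3 : m ^ 2 ≤ (B / R) ^ 2 := sq_le_sq' (abs_le.1 hB2).1 (abs_le.1 hB2).2
    have h4 : a ^ 2 ≤ 1 := pow_le_one₀ (quadCut_nonneg c R x) (quadCut_le_one c R x)
    have h5 : a ^ 2 * m ^ 2 ≤ (B / R) ^ 2 :=
      (mul_le_of_le_one_left (sq_nonneg m) h4).trans h3
    have h6 : σ * k ^ 2 ≤ 100 * C * (B / R) ^ 2 := by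
      calc σ * k ^ 2 ≤ σ * B ^ 2 := by gcongr
        _ = _ := by rw [hσ]; ring
    have h7 : 0 ≤ a ^ 2 * (p - m) ^ 2 := by positivity
    have h8 : 0 ≤ σ * (U x - k) ^ 2 := by positivity
    linarith

/-! ### The Bernstein estimate at the center of a ball -/

lemma le_add_of_sq_le_mul_add_sq {H X Y : ℝ} (hX : 0 ≤ X) (hY : 0 ≤ Y)
    (h : H ^ 2 ≤ X * H + Y ^ 2) : H ≤ X + Y := by
  by_contra! hlt
  nlinarith [mul_pos (sub_pos.2 hlt) (by linarith : 0 < H)]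

lemma min_sq_div_ge {R r : ℝ} (hR : 0 < R) :
    min (r ^ 2) 1 ≤ (1 + R ^ 2) * min ((r / R) ^ 2) 1 := by
  rcases le_total ((r / R) ^ 2) 1 with h | h
  · rw [min_eq_left h]
    refine (min_le_left _ _).trans ?_
    have : r ^ 2 = R ^ 2 * (r / R) ^ 2 := by field_simp
    nlinarith [sq_nonneg (r / R)]
  · rw [min_eq_right h]
    refine (min_le_right _ _).trans ?_
    nlinarith [sq_nonneg R]

set_option maxHeartbeats 1000000 in
lemma exists_bernstein_estimate {n : ℕ} (hn : 0 < n) {θ₀ c₀ : ℝ} (hθ₀ : 0 < θ₀) (hc₀ : 0 < c₀) :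
    ∃ C : ℝ, 0 < C ∧ ∀ e : En n, ‖e‖ = 1 → ∀ U : En n → ℝ, ContDiff ℝ (⊤ : ℕ∞) U →
    ∀ (c : En n) (R B E Γ N Z ω : ℝ), 0 < R → 0 ≤ B → 0 ≤ E → 0 ≤ Γ → 0 ≤ N → 0 ≤ Z → 0 ≤ ω →
    (∀ y, ‖y - c‖ < 2 * R → |U y| ≤ E) →
    (∀ y r, R < r → |avg n r U y| ≤ B ∧ |avg n r (dd n e U) y| ≤ B / R) →
    (∀ x, ‖x - c‖ ≤ R → ∃ A a₀ tW tU : ℝ, θ₀ ≤ A ∧ 0 ≤ a₀ ∧ a₀ ≤ A ∧ a₀ ≤ ω * A ∧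
      a₀ * dd n e U x + tW ≤ Γ ∧ 2 * U x * tU ≤ N + a₀ * Z ∧
      ∀ β p q : ℝ, 0 < β → (∀ r, 0 < r → β * min (r ^ 2) 1 ≤
          p * (dd n e U x - avg n r (dd n e U) x) + q * (U x - avg n r U x)) →
        c₀ * β * (A - a₀) ≤ p * tW + q * tU) →
    dd n e U c ≤ C * (B / R + E / R + (1 + R ^ 2) * Γ
      + (1 + R) * R⁻¹ * (Real.sqrt N + Real.sqrt (ω * Z))) := by
  obtain ⟨σ, hσ, hscale⟩ := exists_bernstein_scale n
  have hm0 := moment_pos hn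
  have hm1 := moment_le_one n
  set κ := min (c₀ * moment n / 16) (1 / 2) with hκ
  have hκ0 : 0 < κ := lt_min (by positivity) (by norm_num)
  set KE := 1 + 4 * σ
  set KB := 1 + 16 * (1 + σ) / moment n
  set K1 := 2 / (κ * θ₀)
  set K2 := σ / κ * (1 / θ₀ + 1)
  have hKE : 0 < KE := by positivity
  have hKB : 0 < KB := by positivity
  have hK1 : 0 < K1 := by positivity
  have hK2 : 0 < K2 := by positivity
  refine ⟨KE + KB + K1 + (1 + K2), by positivity, ?_⟩
  intro e he U hU c R B E Γ N Z ω hR hB hE hΓ hN hZ hω hUE hUB hdata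
  have hW : ContDiff ℝ (⊤ : ℕ∞) (dd n e U) := dd_contDiff hU e
  have hcU := hU.continuous
  have hcW := hW.continuous
  have hcη := quadCut_continuous n c R
  have hcb := quadBar_continuous n c R
  set W := dd n e U with hWdef
  set S := Real.sqrt N + Real.sqrt (ω * Z) with hS
  have hS0 : 0 ≤ S := by positivity
  set tB := B / R with htB
  set tE := E / R with htE
  set tG := (1 + R ^ 2) * Γ with htG
  set tS := (1 + R) * R⁻¹ * S with htS
  have htB0 : 0 ≤ tB := by positivity
  have htE0 : 0 ≤ tE := by positivity
  have htG0 : 0 ≤ tG := by positivity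
  have htS0 : 0 ≤ tS := by positivity
  suffices hmain : ∀ H : ℝ, 0 ≤ H → (∃ x₁, ‖x₁ - c‖ ≤ R ∧ quadCut n c R x₁ * max 0 (W x₁) = H) →
      (∀ y, ‖y - c‖ ≤ R → quadCut n c R y * max 0 (W y) ≤ H) →
      H ≤ KE * tE ∨ H ≤ KB * tB ∨ H ≤ K1 * tG + (1 + K2) * tS by
    obtain ⟨x₁, hx₁, hmax⟩ := (isCompact_closedBall c R).exists_isMaxOn
      ⟨c, mem_closedBall_self hR.le⟩
      (f := fun y => quadCut n c R y * max 0 (W y)) (by fun_prop)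
    have hle : ∀ y, ‖y - c‖ ≤ R → quadCut n c R y * max 0 (W y) ≤
        quadCut n c R x₁ * max 0 (W x₁) := fun y hy =>
      hmax (by rwa [mem_closedBall, dist_eq_norm])
    have hc := hle c (by simpa using hR.le)
    have hqc : quadCut n c R c = 1 := by simp [quadCut]
    rw [hqc, one_mul] at hc
    have hWc : W c ≤ quadCut n c R x₁ * max 0 (W x₁) := (le_max_right _ _).trans hc
    refine hWc.trans ?_
    have p1 := mul_nonneg hKE.le htE0
    have p2 := mul_nonneg hKE.le htB0
    have p3 := mul_nonneg hKE.le htG0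
    have p4 := mul_nonneg hKE.le htS0
    have p5 := mul_nonneg hKB.le htE0
    have p6 := mul_nonneg hKB.le htB0
    have p7 := mul_nonneg hKB.le htG0
    have p8 := mul_nonneg hKB.le htS0
    have p9 := mul_nonneg hK1.le htE0
    have p10 := mul_nonneg hK1.le htB0
    have p11 := mul_nonneg hK1.le htG0
    have p12 := mul_nonneg hK1.le htS0
    have p13 := mul_nonneg hK2.le htE0
    have p14 := mul_nonneg hK2.le htB0
    have p15 := mul_nonneg hK2.le htG0
    have p16 := mul_nonneg hK2.le htS0
    rcases hmain _ (mul_nonneg (quadCut_nonneg _ _ _) (le_max_left _ _))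
      ⟨x₁, by rwa [mem_closedBall, dist_eq_norm] at hx₁, rfl⟩ hle with h | h | h <;> linarith
  rintro H hH0 ⟨x₁, hx₁, hx₁H⟩ hHle
  rcases lt_or_ge (H ^ 2) (4 * σ * tE ^ 2) with hcase | hcase
  · left
    refine (abs_le_of_sq_le_sq' ?_ (by positivity)).2
    have : 4 * σ ≤ KE ^ 2 := by simp only [KE]; nlinarith
    calc H ^ 2 ≤ 4 * σ * tE ^ 2 := hcase.le
      _ ≤ KE ^ 2 * tE ^ 2 := by gcongr
      _ = _ := by ring
  right
  rcases le_or_gt (H ^ 2 * (moment n / 16)) ((1 + σ) * tB ^ 2) with hcase2 | hcase2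
  · left
    refine (abs_le_of_sq_le_sq' ?_ (by positivity)).2
    set s := 16 * (1 + σ) / moment n with hs
    have hs0 : 0 < s := by positivity
    have h1 : H ^ 2 ≤ s * tB ^ 2 := by
      have : s * tB ^ 2 = ((1 + σ) * tB ^ 2) / (moment n / 16) := by rw [hs]; field_simp
      rw [this, le_div_iff₀ (by positivity)]
      exact hcase2
    have h2 : s ≤ KB ^ 2 := by simp only [KB]; nlinarith
    calc H ^ 2 ≤ s * tB ^ 2 := h1
      _ ≤ KB ^ 2 * tB ^ 2 := by gcongr
      _ = _ := by ring
  right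
  set M := H ^ 2 / 8 with hM
  have hM0 : 0 ≤ M := by positivity
  set ψ : En n → ℝ := fun y => quadCut n c R y ^ 2 * max 0 (W y) ^ 2 + σ / R ^ 2 * U y ^ 2
    - M * quadBar n c R y with hψ
  obtain ⟨x, hx, hxmax⟩ := (isCompact_closedBall c R).exists_isMaxOn
      ⟨c, mem_closedBall_self hR.le⟩ (f := ψ) (by fun_prop)
  rw [mem_closedBall, dist_eq_norm] at hx
  have hσE : ∀ y, ‖y - c‖ < 2 * R → σ / R ^ 2 * U y ^ 2 ≤ H ^ 2 / 4 := by
    intro y hy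
    have h1 : U y ^ 2 ≤ E ^ 2 := sq_le_sq' (abs_le.1 (hUE y hy)).1 (abs_le.1 (hUE y hy)).2
    have h2 : σ / R ^ 2 * U y ^ 2 ≤ σ / R ^ 2 * E ^ 2 := by gcongr
    have h3 : σ / R ^ 2 * E ^ 2 = σ * tE ^ 2 := by rw [htE]; ring
    linarith
  have hψx : H ^ 2 / 2 ≤ ψ x := by
    have h1 : ψ x₁ ≤ ψ x := hxmax (by rwa [mem_closedBall, dist_eq_norm])
    have h2 : quadCut n c R x₁ ^ 2 * max 0 (W x₁) ^ 2 = H ^ 2 := by rw [← mul_pow, hx₁H]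
    have h3 : 0 ≤ σ / R ^ 2 * U x₁ ^ 2 := by positivity
    have h4 : M * quadBar n c R x₁ ≤ M * 4 := by
      gcongr; exact quadBar_le_four _ _ _
    have h5 : ψ x₁ = quadCut n c R x₁ ^ 2 * max 0 (W x₁) ^ 2 + σ / R ^ 2 * U x₁ ^ 2
      - M * quadBar n c R x₁ := rfl
    linarith
  have ha : ∀ y, ‖y - c‖ < 2 * R → ψ y ≤ ψ x := by
    intro y hy
    rcases le_or_gt ‖y - c‖ R with h | h
    · exact hxmax (by rwa [mem_closedBall, dist_eq_norm])
    · have h1 : quadCut n c R y = 0 := by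
        refine max_eq_left (sub_nonpos.2 ?_)
        rw [one_le_div (by positivity)]
        gcongr
      have h2 := hσE y hy
      have h3 : 0 ≤ M * quadBar n c R y := mul_nonneg hM0 (quadBar_nonneg _ _ _)
      have h5 : ψ y = quadCut n c R y ^ 2 * max 0 (W y) ^ 2 + σ / R ^ 2 * U y ^ 2
        - M * quadBar n c R y := rfl
      rw [h1, zero_pow two_ne_zero, zero_mul, zero_add] at h5
      have h6 := sq_nonneg H
      linarith
  have hψdef : ψ x = quadCut n c R x ^ 2 * max 0 (W x) ^ 2 + σ / R ^ 2 * U x ^ 2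
    - M * quadBar n c R x := rfl
  have hb : M * quadBar n c R x ≤ quadCut n c R x ^ 2 * max 0 (W x) ^ 2 + σ / R ^ 2 * U x ^ 2 := by
    have h6 := sq_nonneg H
    linarith
  have hsc := hscale e he U hU c x R M B hR hx hM0 ha hb (hUB x)
  obtain ⟨A, a₀, tW, tU, hA, ha0, ha0A, haω, hWe, hUe, hop⟩ := hdata x hx
  have hA0 : 0 < A := hθ₀.trans_le hA
  set a := quadCut n c R x
  set p := max 0 (W x) with hp
  have hp0 : 0 ≤ p := le_max_left _ _
  have haa0 : 0 ≤ a := quadCut_nonneg c R x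
  have haa1 : a ≤ 1 := quadCut_le_one c R x
  have hap : H ^ 2 / 4 ≤ a ^ 2 * p ^ 2 := by
    have h1 := hσE x (by linarith)
    have h3 : 0 ≤ M * quadBar n c R x := mul_nonneg hM0 (quadBar_nonneg _ _ _)
    linarith
  have happ : a ^ 2 * p ≤ H := by
    have := hHle x hx
    calc a ^ 2 * p = a * (a * p) := by ring
      _ ≤ 1 * (a * p) := by gcongr
      _ ≤ H := by rw [one_mul]; exact this
  have hpW : p * W x = p ^ 2 := by
    rcases le_total (W x) 0 with h | h
    · rw [hp, max_eq_left h]; ring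
    · rw [hp, max_eq_right h]; ring
  set β := H ^ 2 * (moment n / 16) / (1 + R ^ 2) with hβ
  have hβ0 : 0 < β := by
    have : 0 < H ^ 2 * (moment n / 16) := lt_of_le_of_lt (by positivity) hcase2
    positivity
  have hR2 : 0 < 1 + R ^ 2 := by positivity
  have hop' := hop β (2 * (a ^ 2 * p)) (2 * (σ / R ^ 2) * U x) hβ0 (by
    intro r hr
    refine le_trans ?_ (hsc r hr)
    calc β * min (r ^ 2) 1 ≤ β * ((1 + R ^ 2) * min ((r / R) ^ 2) 1) := by
          gcongr; exact min_sq_div_ge hR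
      _ = H ^ 2 * (moment n / 16) * min ((r / R) ^ 2) 1 := by rw [hβ]; field_simp
      _ ≤ _ := by
        refine mul_le_mul_of_nonneg_right ?_ (le_min (sq_nonneg _) zero_le_one)
        have h1 : M * moment n = 2 * (H ^ 2 * (moment n / 16)) := by rw [hM]; ring
        rw [h1, ← htB]
        linarith)
  have hWe' : 2 * (a ^ 2 * p) * tW ≤ 2 * H * Γ - a₀ * (H ^ 2 / 2) := by
    have h1 : 2 * (a ^ 2 * p) * tW ≤ 2 * (a ^ 2 * p) * (Γ - a₀ * W x) := by
      gcongr; linarith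
    have h2 : 2 * (a ^ 2 * p) * (Γ - a₀ * W x) = 2 * (a ^ 2 * p) * Γ
      - 2 * a₀ * (a ^ 2 * p ^ 2) := by linear_combination (-2) * a₀ * a ^ 2 * hpW
    have h3 : 2 * (a ^ 2 * p) * Γ ≤ 2 * H * Γ := by gcongr
    have h4 : a₀ * (H ^ 2 / 4) ≤ a₀ * (a ^ 2 * p ^ 2) := by gcongr
    linarith
  have hUe' : 2 * (σ / R ^ 2) * U x * tU ≤ σ / R ^ 2 * (N + a₀ * Z) := by
    calc 2 * (σ / R ^ 2) * U x * tU = σ / R ^ 2 * (2 * U x * tU) := by ring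
      _ ≤ _ := by gcongr
  have hmain : κ / (1 + R ^ 2) * H ^ 2 * A ≤ 2 * H * Γ + σ / R ^ 2 * (N + a₀ * Z) := by
    have h1 : κ / (1 + R ^ 2) * H ^ 2 * (A - a₀) ≤ c₀ * β * (A - a₀) := by
      refine mul_le_mul_of_nonneg_right ?_ (by linarith)
      rw [hβ]
      calc κ / (1 + R ^ 2) * H ^ 2 ≤ (c₀ * moment n / 16) / (1 + R ^ 2) * H ^ 2 := by
            gcongr; exact min_le_left _ _
        _ = _ := by ring
    have h2 : κ / (1 + R ^ 2) ≤ 1 / 2 := by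
      refine (div_le_self hκ0.le (by nlinarith [sq_nonneg R])).trans (min_le_right _ _)
    have h3 : a₀ * (κ / (1 + R ^ 2) * H ^ 2) ≤ a₀ * (1 / 2 * H ^ 2) := by gcongr
    linarith
  have hmain2 : κ / (1 + R ^ 2) * H ^ 2 ≤ 2 * H * Γ / θ₀ + σ / R ^ 2 * (N / θ₀ + ω * Z) := by
    have h1 : 2 * H * Γ ≤ 2 * H * Γ / θ₀ * A := by
      rw [div_mul_eq_mul_div, le_div_iff₀ hθ₀]; gcongr
    have h2 : N ≤ N / θ₀ * A := by
      rw [div_mul_eq_mul_div, le_div_iff₀ hθ₀]; gcongr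
    have h3 : a₀ * Z ≤ ω * A * Z := mul_le_mul_of_nonneg_right haω hZ
    refine le_of_mul_le_mul_right ?_ hA0
    have h4 : σ / R ^ 2 * (N + a₀ * Z) ≤ σ / R ^ 2 * ((N / θ₀ + ω * Z) * A) := by
      gcongr; linarith
    linarith
  have hN' : N / θ₀ + ω * Z ≤ (1 / θ₀ + 1) * S ^ 2 := by
    have h1 : N + ω * Z ≤ S ^ 2 := by
      rw [hS, add_sq, Real.sq_sqrt hN, Real.sq_sqrt (by positivity)]
      have : 0 ≤ 2 * Real.sqrt N * Real.sqrt (ω * Z) := by positivity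
      linarith
    have h2 : 0 ≤ 1 / θ₀ := by positivity
    have h3 : 0 ≤ ω * Z := by positivity
    have h4 : N / θ₀ = 1 / θ₀ * N := by ring
    rw [h4]
    calc 1 / θ₀ * N + ω * Z ≤ (1 / θ₀ + 1) * (N + ω * Z) := by
          have h5 : 0 ≤ 1 / θ₀ * (ω * Z) := mul_nonneg h2 h3
          linarith
      _ ≤ _ := by gcongr
  refine le_add_of_sq_le_mul_add_sq (by positivity) (by positivity) ?_
  have h1 : H ^ 2 = (1 + R ^ 2) / κ * (κ / (1 + R ^ 2) * H ^ 2) := by field_simp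
  have h2 : (1 + R ^ 2) / κ * (σ / R ^ 2 * ((1 / θ₀ + 1) * S ^ 2))
      = K2 * ((1 + R ^ 2) / R ^ 2 * S ^ 2) := by simp only [K2]; ring
  have h3 : (1 + R ^ 2) / R ^ 2 * S ^ 2 ≤ tS ^ 2 := by
    have : tS ^ 2 = (1 + R) ^ 2 / R ^ 2 * S ^ 2 := by rw [htS]; field_simp
    rw [this]
    gcongr
    linarith [add_sq 1 R]
  have h4 : K2 ≤ (1 + K2) ^ 2 := by have := sq_nonneg K2; linarith [add_sq 1 K2]
  have h5 : (1 + R ^ 2) / κ * (2 * H * Γ / θ₀) = K1 * tG * H := by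
    simp only [K1, htG]; field_simp
  calc H ^ 2 = (1 + R ^ 2) / κ * (κ / (1 + R ^ 2) * H ^ 2) := h1
    _ ≤ (1 + R ^ 2) / κ * (2 * H * Γ / θ₀ + σ / R ^ 2 * ((1 / θ₀ + 1) * S ^ 2)) := by
      gcongr
      refine hmain2.trans ?_
      gcongr
    _ = K1 * tG * H + K2 * ((1 + R ^ 2) / R ^ 2 * S ^ 2) := by rw [mul_add, h2, h5]
    _ ≤ K1 * tG * H + (1 + K2) ^ 2 * tS ^ 2 := by gcongr
    _ = _ := by ring

/-! ### Kernels of fractional Laplacians -/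

lemma integral_min_sq_mul_rpow {s : ℝ} (hs : s ∈ Ioo (0 : ℝ) 1) :
    IntegrableOn (fun y : ℝ => min (y ^ 2) 1 * y ^ (-1 - 2 * s)) (Ioi 0) ∧
      ∫ y in Ioi (0 : ℝ), min (y ^ 2) 1 * y ^ (-1 - 2 * s) = 1 / (2 * (s * (1 - s))) := by
  obtain ⟨hs0, hs1⟩ := hs
  have hU : Ioi (0 : ℝ) = Ioc 0 1 ∪ Ioi 1 := (Ioc_union_Ioi_eq_Ioi zero_le_one).symm
  have hd : Disjoint (Ioc (0 : ℝ) 1) (Ioi 1) := by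
    rw [Set.disjoint_left]; intro y hy hy'; exact absurd hy.2 (not_le.2 hy')
  have e1 : EqOn (fun y : ℝ => y ^ (1 - 2 * s)) (fun y : ℝ => min (y ^ 2) 1 * y ^ (-1 - 2 * s))
      (Ioc 0 1) := by
    intro y hy
    have h1 : min (y ^ 2) 1 = y ^ (2 : ℝ) := by
      rw [min_eq_left (pow_le_one₀ hy.1.le hy.2), ← Real.rpow_natCast]; norm_num
    simp only [h1]
    rw [← Real.rpow_add hy.1]
    congr 1; ring
  have e2 : EqOn (fun y : ℝ => y ^ (-1 - 2 * s)) (fun y : ℝ => min (y ^ 2) 1 * y ^ (-1 - 2 * s))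
      (Ioi 1) := by
    intro y hy
    have h1 : min (y ^ 2) 1 = 1 := min_eq_right (one_le_pow₀ (le_of_lt hy))
    simp only [h1, one_mul]
  have i1 : IntegrableOn (fun y : ℝ => y ^ (1 - 2 * s)) (Ioc 0 1) := by
    have := intervalIntegral.intervalIntegrable_rpow' (a := 0) (b := 1)
      (show -1 < 1 - 2 * s by linarith)
    rwa [intervalIntegrable_iff_integrableOn_Ioc_of_le zero_le_one] at this
  have i2 : IntegrableOn (fun y : ℝ => y ^ (-1 - 2 * s)) (Ioi 1) :=
    integrableOn_Ioi_rpow_of_lt (by linarith) one_pos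
  have i1' := i1.congr_fun e1 measurableSet_Ioc
  have i2' := i2.congr_fun e2 measurableSet_Ioi
  refine ⟨by rw [hU]; exact i1'.union i2', ?_⟩
  rw [hU, setIntegral_union hd measurableSet_Ioi i1' i2',
    ← setIntegral_congr_fun measurableSet_Ioc e1, ← setIntegral_congr_fun measurableSet_Ioi e2,
    ← intervalIntegral.integral_of_le zero_le_one, integral_rpow (Or.inl (by linarith)),
    integral_Ioi_rpow_of_lt (by linarith) one_pos]
  have h1 : (1 - s) ≠ 0 := by linarith
  have h2 : (1 - 2 * s + 1) = 2 * (1 - s) := by ring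
  have h3 : (-1 - 2 * s + 1) = -(2 * s) := by ring
  rw [h2, h3, Real.zero_rpow (by positivity), Real.one_rpow, Real.one_rpow]
  field_simp
  ring

/-- The homogeneous kernel of order `2 * s`. -/
def fker (n : ℕ) (s : ℝ) (z : En n) : ℝ := ‖z‖ ^ (-((n : ℝ) + 2 * s))

lemma fker_nonneg (n : ℕ) (s : ℝ) (z : En n) : 0 ≤ fker n s z := Real.rpow_nonneg (norm_nonneg z) _

lemma fker_measurable (n : ℕ) (s : ℝ) : Measurable (fker n s) := by
  unfold fker; fun_prop

/-- The volume of the unit sphere. -/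
def sphVol (n : ℕ) : ℝ := n * (volume : Measure (En n)).real (ball 0 1)

lemma sphVol_nonneg (n : ℕ) : 0 ≤ sphVol n := by unfold sphVol; positivity

lemma integral_min_sq_mul_fker {n : ℕ} (hn : 0 < n) {s : ℝ} (hs : s ∈ Ioo (0 : ℝ) 1) :
    Integrable (fun z : En n => min (‖z‖ ^ 2) 1 * fker n s z) ∧
      ∫ z : En n, min (‖z‖ ^ 2) 1 * fker n s z = sphVol n / (2 * (s * (1 - s))) := by
  have : Nonempty (Fin n) := ⟨⟨0, hn⟩⟩
  have : Nontrivial (En n) := inferInstance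
  have hdim : Module.finrank ℝ (En n) = n := by simp
  have he : EqOn (fun y : ℝ => min (y ^ 2) 1 * y ^ (-1 - 2 * s))
      (fun y : ℝ => y ^ (n - 1) • (min (y ^ 2) 1 * y ^ (-((n : ℝ) + 2 * s)))) (Ioi 0) := by
    intro y hy
    have h1 : y ^ (n - 1) = y ^ ((n : ℝ) - 1) := by
      rw [← Real.rpow_natCast, Nat.cast_pred hn]
    simp only [smul_eq_mul, h1]
    have h2 : y ^ (-1 - 2 * s) = y ^ ((n : ℝ) - 1) * y ^ (-((n : ℝ) + 2 * s)) := by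
      rw [← Real.rpow_add hy]; congr 1; ring
    rw [h2]; ring
  obtain ⟨h1, h2⟩ := integral_min_sq_mul_rpow hs
  have i1 := integrable_fun_norm_addHaar (E := En n) volume
    (f := fun y : ℝ => min (y ^ 2) 1 * y ^ (-((n : ℝ) + 2 * s)))
  have i2 := integral_fun_norm_addHaar (E := En n) volume
    (fun y : ℝ => min (y ^ 2) 1 * y ^ (-((n : ℝ) + 2 * s)))
  rw [hdim] at i1 i2
  refine ⟨i1.2 (h1.congr_fun he measurableSet_Ioi), ?_⟩
  rw [← setIntegral_congr_fun measurableSet_Ioi he, h2] at i2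
  refine i2.trans ?_
  rw [nsmul_eq_mul, smul_eq_mul, sphVol]
  ring

/-- The factor of the normalizing constant which is regular up to `s = 0` and `s = 1`. -/
def cnsReg (n : ℕ) (s : ℝ) : ℝ :=
  (4 : ℝ) ^ s * Real.Gamma ((n : ℝ) / 2 + s) / (Real.pi ^ ((n : ℝ) / 2) * Real.Gamma (2 - s))

lemma cns_eq (n : ℕ) {s : ℝ} (hs : s < 1) : cns n s = s * (1 - s) * cnsReg n s := by
  have h1 : Real.Gamma (2 - s) = (1 - s) * Real.Gamma (1 - s) := by
    rw [← Real.Gamma_add_one (by linarith)]; congr 1; ring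
  have h2 : 1 - s ≠ 0 := by linarith
  have h3 : Real.Gamma (1 - s) ≠ 0 := (Real.Gamma_pos_of_pos (by linarith)).ne'
  have h4 : Real.pi ^ ((n : ℝ) / 2) ≠ 0 := (Real.rpow_pos_of_pos Real.pi_pos _).ne'
  rw [cns, cnsReg, h1]
  field_simp

lemma continuousOn_Gamma_pos : ContinuousOn Real.Gamma (Ioi 0) := fun s hs =>
  (Real.differentiableAt_Gamma fun m => by
    have : (0 : ℝ) ≤ m := Nat.cast_nonneg m
    have hs' : 0 < s := hs
    linarith).continuousAt.continuousWithinAt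

lemma cnsReg_continuousOn {n : ℕ} (hn : 0 < n) : ContinuousOn (cnsReg n) (Icc 0 1) := by
  have hn' : (0 : ℝ) < n := Nat.cast_pos.2 hn
  unfold cnsReg
  refine ContinuousOn.div (ContinuousOn.mul ?_ ?_) (continuousOn_const.mul ?_) ?_
  · exact (Real.continuous_const_rpow (by norm_num)).continuousOn
  · exact continuousOn_Gamma_pos.comp (by fun_prop) fun s hs => by
      have := hs.1
      simp only [mem_Ioi]; positivity
  · exact continuousOn_Gamma_pos.comp (by fun_prop) fun s hs => by
      have := hs.2
      simp only [mem_Ioi]; linarith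
  · intro s hs
    exact mul_ne_zero (Real.rpow_pos_of_pos Real.pi_pos _).ne'
      (Real.Gamma_pos_of_pos (by linarith [hs.2])).ne'

lemma cnsReg_pos {n : ℕ} (hn : 0 < n) {s : ℝ} (hs : s ∈ Icc (0 : ℝ) 1) : 0 < cnsReg n s := by
  have hn' : (0 : ℝ) < n := Nat.cast_pos.2 hn
  have h1 := Real.Gamma_pos_of_pos (show 0 < (n : ℝ) / 2 + s by have := hs.1; positivity)
  have h2 := Real.Gamma_pos_of_pos (show 0 < 2 - s by linarith [hs.2])
  have := Real.pi_pos
  unfold cnsReg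
  positivity

lemma exists_cnsReg_bounds {n : ℕ} (hn : 0 < n) : ∃ c C : ℝ, 0 < c ∧ 0 < C ∧
    ∀ s ∈ Icc (0 : ℝ) 1, c ≤ cnsReg n s ∧ cnsReg n s ≤ C := by
  have hne : (Icc (0 : ℝ) 1).Nonempty := ⟨0, by simp⟩
  obtain ⟨a, ha, hmin⟩ := isCompact_Icc.exists_isMinOn hne (cnsReg_continuousOn hn)
  obtain ⟨b, hb, hmax⟩ := isCompact_Icc.exists_isMaxOn hne (cnsReg_continuousOn hn)
  exact ⟨_, _, cnsReg_pos hn ha, cnsReg_pos hn hb, fun s hs => ⟨hmin hs, hmax hs⟩⟩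

lemma cns_continuousOn {n : ℕ} (hn : 0 < n) : ContinuousOn (cns n) (Ioo 0 1) := by
  have h : ContinuousOn (fun s => s * (1 - s) * cnsReg n s) (Ioo 0 1) :=
    ContinuousOn.mul (by fun_prop) ((cnsReg_continuousOn hn).mono Ioo_subset_Icc_self)
  exact h.congr fun s hs => cns_eq n hs.2

/-! ### Second differences -/

/-- The symmetric second difference. -/
def secDiff (n : ℕ) (φ : En n → ℝ) (x z : En n) : ℝ := 2 * φ x - φ (x + z) - φ (x - z)

/-- Smooth bounded functions. -/
def SmoothBdd (n : ℕ) (φ : En n → ℝ) : Prop :=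
  ContDiff ℝ (⊤ : ℕ∞) φ ∧ ∃ M : ℝ, ∀ y, |φ y| ≤ M

lemma hasDerivAt_line {n : ℕ} {φ : En n → ℝ} (hφ : ContDiff ℝ (⊤ : ℕ∞) φ) (x e : En n) (t : ℝ) :
    HasDerivAt (fun t : ℝ => φ (x + t • e)) (dd n e φ (x + t • e)) t := by
  have h1 : HasDerivAt (fun t : ℝ => x + t • e) e t := by
    simpa using ((hasDerivAt_id t).smul_const e).const_add x
  exact ((hφ.differentiable (by simp)) (x + t • e)).hasFDerivAt.comp_hasDerivAt t h1

lemma dd_neg_dir {n : ℕ} (e : En n) (φ : En n → ℝ) (x : En n) : dd n (-e) φ x = -dd n e φ x := by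
  simp [dd]

lemma hasDerivAt_line_sub {n : ℕ} {φ : En n → ℝ} (hφ : ContDiff ℝ (⊤ : ℕ∞) φ) (x e : En n)
    (t : ℝ) : HasDerivAt (fun t : ℝ => φ (x - t • e)) (-dd n e φ (x - t • e)) t := by
  have h := hasDerivAt_line hφ x (-e) t
  simpa only [smul_neg, ← sub_eq_add_neg, dd_neg_dir] using h

lemma fderiv_contDiff {n : ℕ} {φ : En n → ℝ} (hφ : ContDiff ℝ (⊤ : ℕ∞) φ) :
    ContDiff ℝ (⊤ : ℕ∞) (fderiv ℝ φ) :=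
  hφ.fderiv_right (m := (⊤ : ℕ∞)) (by exact_mod_cast le_rfl)

lemma exists_secDiff_bound {n : ℕ} {φ : En n → ℝ} (hφ : SmoothBdd n φ) (x : En n) :
    ∃ K : ℝ, 0 ≤ K ∧ ∀ y, ‖y - x‖ ≤ 1 → (∀ z, |secDiff n φ y z| ≤ K * min (‖z‖ ^ 2) 1) ∧
      ∀ e, ‖e‖ = 1 → |dd2 n e φ y| ≤ K := by
  obtain ⟨hs, M, hM⟩ := hφ
  have hD := fderiv_contDiff hs
  have hDD : Continuous fun w => ‖fderiv ℝ (fderiv ℝ φ) w‖ :=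
    continuous_norm.comp (hD.continuous_fderiv (by simp))
  obtain ⟨K₁, hK₁'⟩ := (isCompact_closedBall x 2).exists_bound_of_continuousOn hDD.continuousOn
  have hK₁ : ∀ w ∈ closedBall x 2, ‖fderiv ℝ (fderiv ℝ φ) w‖ ≤ K₁ := fun w hw =>
    (le_abs_self _).trans (hK₁' w hw)
  have hK0 : 0 ≤ K₁ := (norm_nonneg (fderiv ℝ (fderiv ℝ φ) x)).trans
    (hK₁ x (mem_closedBall_self (by norm_num)))
  have hM0 : 0 ≤ M := (abs_nonneg _).trans (hM x)
  refine ⟨2 * K₁ + 4 * M, by positivity, fun y hy => ⟨fun z => ?_, fun e he => ?_⟩⟩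
  · rcases le_or_gt ‖z‖ 1 with hz | hz
    · have hz2 : ‖z‖ ^ 2 ≤ 1 := pow_le_one₀ (norm_nonneg z) hz
      rw [min_eq_left hz2]
      have hmem : ∀ t ∈ Icc (0 : ℝ) 1, x - x + y + t • z ∈ closedBall x 2 ∧
          x - x + y - t • z ∈ closedBall x 2 := by
        intro t ht
        have h1 : ‖t • z‖ ≤ 1 := by
          rw [norm_smul, Real.norm_eq_abs, abs_of_nonneg ht.1]
          nlinarith [ht.1, ht.2, norm_nonneg z]
        simp only [sub_self, zero_add, mem_closedBall, dist_eq_norm]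
        constructor
        · calc ‖y + t • z - x‖ = ‖(y - x) + t • z‖ := by congr 1; abel
            _ ≤ 2 := by linarith [norm_add_le (y - x) (t • z)]
        · calc ‖y - t • z - x‖ = ‖(y - x) - t • z‖ := by congr 1; abel
            _ ≤ 2 := by linarith [norm_sub_le (y - x) (t • z)]
      simp only [sub_self, zero_add] at hmem
      have hder : ∀ t ∈ Icc (0 : ℝ) 1, HasDerivWithinAt (fun t : ℝ => φ (y + t • z) + φ (y - t • z))
          (dd n z φ (y + t • z) + -dd n z φ (y - t • z)) (Icc 0 1) t := fun t _ =>
        ((hasDerivAt_line hs y z t).add (hasDerivAt_line_sub hs y z t)).hasDerivWithinAt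
      have hbd : ∀ t ∈ Ico (0 : ℝ) 1,
          ‖dd n z φ (y + t • z) + -dd n z φ (y - t • z)‖ ≤ 2 * K₁ * ‖z‖ ^ 2 := by
        intro t ht
        obtain ⟨m1, m2⟩ := hmem t ⟨ht.1, ht.2.le⟩
        have h1 : ‖fderiv ℝ φ (y + t • z) - fderiv ℝ φ (y - t • z)‖
            ≤ K₁ * ‖(y + t • z) - (y - t • z)‖ :=
          (convex_closedBall x 2).norm_image_sub_le_of_norm_fderiv_le (𝕜 := ℝ)
            (fun w _ => hD.differentiable (by simp) w) (fun w hw => hK₁ w hw) m2 m1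
        have h2 : (y + t • z) - (y - t • z) = (2 * t) • z := by module
        rw [h2, norm_smul, Real.norm_eq_abs, abs_of_nonneg (by linarith [ht.1])] at h1
        have h3 : dd n z φ (y + t • z) + -dd n z φ (y - t • z)
            = (fderiv ℝ φ (y + t • z) - fderiv ℝ φ (y - t • z)) z := by
          simp [dd, sub_eq_add_neg]
        rw [h3]
        refine (ContinuousLinearMap.le_opNorm _ _).trans ?_
        calc _ ≤ K₁ * (2 * t * ‖z‖) * ‖z‖ := by gcongr
          _ = t * (2 * K₁ * ‖z‖ ^ 2) := by ring
          _ ≤ 1 * (2 * K₁ * ‖z‖ ^ 2) := by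
            have := ht.2.le
            gcongr
          _ = _ := one_mul _
      have h4 := norm_image_sub_le_of_norm_deriv_le_segment_01' hder hbd
      have h5 : secDiff n φ y z = -(φ (y + (1 : ℝ) • z) + φ (y - (1 : ℝ) • z)
          - (φ (y + (0 : ℝ) • z) + φ (y - (0 : ℝ) • z))) := by
        simp [secDiff]; ring
      rw [h5, abs_neg, ← Real.norm_eq_abs]
      refine h4.trans ?_
      have : 0 ≤ 4 * M * ‖z‖ ^ 2 := by positivity
      linarith
    · rw [min_eq_right (one_le_pow₀ hz.le), mul_one, secDiff]
      have h1 := abs_le.1 (hM y)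
      have h2 := abs_le.1 (hM (y + z))
      have h3 := abs_le.1 (hM (y - z))
      rw [abs_le]
      constructor <;> linarith
  · have hy2 : y ∈ closedBall x 2 := by
      rw [mem_closedBall, dist_eq_norm]; linarith
    have := (abs_dd_dd_le hs he he y).trans (hK₁ y hy2)
    have h : dd2 n e φ y = dd n e (dd n e φ) y := rfl
    rw [h]
    linarith

lemma secDiff_continuous {n : ℕ} {φ : En n → ℝ} (hφ : Continuous φ) (x : En n) :
    Continuous (secDiff n φ x) := by
  unfold secDiff; fun_prop

lemma tendsto_secDiff_div_sq {n : ℕ} {φ : En n → ℝ} (hφ : ContDiff ℝ (⊤ : ℕ∞) φ) (x z : En n) :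
    Tendsto (fun r : ℝ => secDiff n φ x (r • z) / r ^ 2) (nhdsWithin 0 (Ioi 0))
      (nhds (-dd n z (dd n z φ) x)) := by
  have hw := dd_contDiff hφ z
  set w := dd n z φ with hwdef
  have hf : ∀ t : ℝ, HasDerivAt (fun r : ℝ => secDiff n φ x (r • z))
      (w (x - t • z) - w (x + t • z)) t := by
    intro t
    have := ((hasDerivAt_line hφ x z t).const_sub (2 * φ x)).sub (hasDerivAt_line_sub hφ x z t)
    exact this.congr_deriv (by ring)
  have hq : HasDerivAt (fun t : ℝ => w (x - t • z) - w (x + t • z)) (-2 * dd n z w x) 0 := by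
    have := (hasDerivAt_line_sub hw x z 0).sub (hasDerivAt_line hw x z 0)
    exact this.congr_deriv (by simp; ring)
  have hlim : Tendsto (fun t : ℝ => (w (x - t • z) - w (x + t • z)) / (2 * t))
      (nhdsWithin 0 (Ioi 0)) (nhds (-dd n z w x)) := by
    have h1 := (hasDerivAt_iff_tendsto_slope_zero.1 hq).mono_left
      (nhdsWithin_mono 0 (show Ioi (0 : ℝ) ⊆ {0}ᶜ from fun t ht => ne_of_gt ht))
    have h2 := h1.const_mul (1 / 2 : ℝ)
    convert h2 using 2
    · simp; ring
    · ring
  refine HasDerivAt.lhopital_zero_nhdsGT (f' := fun t => w (x - t • z) - w (x + t • z))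
    (g' := fun t => 2 * t) (Eventually.of_forall hf) (Eventually.of_forall fun t => ?_) ?_ ?_ ?_ hlim
  · simpa using hasDerivAt_pow 2 t
  · filter_upwards [self_mem_nhdsWithin] with t ht
    have : (0 : ℝ) < t := ht
    positivity
  · have h1 := (hf 0).continuousAt.tendsto
    simp only [zero_smul] at h1
    have h2 : secDiff n φ x 0 = 0 := by simp [secDiff]; ring
    rw [h2] at h1
    exact h1.mono_left nhdsWithin_le_nhds
  · have h1 : Tendsto (fun t : ℝ => t ^ 2) (nhds 0) (nhds (0 ^ 2)) := (continuous_pow 2).tendsto 0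
    rw [zero_pow two_ne_zero] at h1
    exact h1.mono_left nhdsWithin_le_nhds

/-! ### Representation of the operators by second differences -/

/-- The fractional Laplacian as an absolutely convergent integral of second differences. -/
def fracSec (n : ℕ) (s : ℝ) (φ : En n → ℝ) (x : En n) : ℝ :=
  cns n s / 2 * ∫ z, secDiff n φ x z * fker n s z

/-- The operator with its zero-order part removed. -/
def opPos (n : ℕ) (μ : Measure ℝ) (φ : En n → ℝ) (x : En n) : ℝ :=
  (∫ s in Ioo (0 : ℝ) 1, fracSec n s φ x ∂μ) +
    μ.real {1} * (-∑ i : Fin n, dd2 n (EuclideanSpace.single i 1) φ x)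

lemma integrable_mul_fker_of_le {n : ℕ} (hn : 0 < n) {s : ℝ} (hs : s ∈ Ioo (0 : ℝ) 1)
    {ψ : En n → ℝ} (hψ : AEStronglyMeasurable ψ) {K : ℝ}
    (hK : ∀ z, |ψ z| ≤ K * min (‖z‖ ^ 2) 1) : Integrable fun z => ψ z * fker n s z := by
  refine ((integral_min_sq_mul_fker hn hs).1.const_mul K).mono'
    (hψ.mul (fker_measurable n s).aestronglyMeasurable) (Eventually.of_forall fun z => ?_)
  rw [Real.norm_eq_abs, abs_mul, abs_of_nonneg (fker_nonneg n s z), ← mul_assoc]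
  exact mul_le_mul_of_nonneg_right (hK z) (fker_nonneg n s z)

lemma abs_integral_mul_fker_le {n : ℕ} (hn : 0 < n) {s : ℝ} (hs : s ∈ Ioo (0 : ℝ) 1)
    {ψ : En n → ℝ} {K : ℝ} (hK : ∀ z, |ψ z| ≤ K * min (‖z‖ ^ 2) 1) :
    |∫ z, ψ z * fker n s z| ≤ K * (sphVol n / (2 * (s * (1 - s)))) := by
  rw [← (integral_min_sq_mul_fker hn hs).2, ← integral_const_mul, ← Real.norm_eq_abs]
  refine norm_integral_le_of_norm_le ((integral_min_sq_mul_fker hn hs).1.const_mul K)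
    (Eventually.of_forall fun z => ?_)
  rw [Real.norm_eq_abs, abs_mul, abs_of_nonneg (fker_nonneg n s z), ← mul_assoc]
  exact mul_le_mul_of_nonneg_right (hK z) (fker_nonneg n s z)

lemma fracLap_truncated_eq {n : ℕ} (hn : 0 < n) {s : ℝ} (hs : s ∈ Ioo (0 : ℝ) 1)
    {φ : En n → ℝ} (hφ : Continuous φ) {M : ℝ} (hM : ∀ y, |φ y| ≤ M) (x : En n) {ε : ℝ}
    (hε : 0 < ε) :
    ∫ y in {y : En n | ε ≤ dist y x}, (φ x - φ y) * (cns n s * ‖x - y‖ ^ (-((n : ℝ) + 2 * s)))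
      = cns n s / 2 * ∫ z, {z : En n | ε ≤ ‖z‖}.indicator (secDiff n φ x) z * fker n s z := by
  have hS : MeasurableSet {z : En n | ε ≤ ‖z‖} := measurableSet_le measurable_const measurable_norm
  have hSx : MeasurableSet {y : En n | ε ≤ dist y x} :=
    measurableSet_le measurable_const (measurable_id.dist measurable_const)
  set c := cns n s
  set G : En n → ℝ := {y : En n | ε ≤ dist y x}.indicator
    fun y => (φ x - φ y) * (c * ‖x - y‖ ^ (-((n : ℝ) + 2 * s)))
  have hG : ∀ y, ε ≤ dist y x → G y = (φ x - φ y) * (c * ‖x - y‖ ^ (-((n : ℝ) + 2 * s))) :=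
    fun y hy => indicator_of_mem (s := {y : En n | ε ≤ dist y x}) hy _
  have hG' : ∀ y, ¬ ε ≤ dist y x → G y = 0 :=
    fun y hy => indicator_of_notMem (s := {y : En n | ε ≤ dist y x}) hy _
  have hM0 : 0 ≤ M := (abs_nonneg _).trans (hM x)
  have hm : 0 < min (ε ^ 2) 1 := lt_min (by positivity) one_pos
  have key : ∀ ψ : En n → ℝ, Continuous ψ → (∀ z, |ψ z| ≤ M) →
      Integrable fun z => {z : En n | ε ≤ ‖z‖}.indicator (fun z => φ x - ψ z) z * fker n s z := by
    intro ψ hψ hψM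
    refine integrable_mul_fker_of_le hn hs (K := 2 * M / min (ε ^ 2) 1)
      ((continuous_const.sub hψ).aestronglyMeasurable.indicator hS) fun z => ?_
    by_cases hz : ε ≤ ‖z‖
    · rw [indicator_of_mem (by exact hz)]
      have h1 : min (ε ^ 2) 1 ≤ min (‖z‖ ^ 2) 1 := by gcongr
      have h2 : |φ x - ψ z| ≤ 2 * M := by
        have := abs_sub (φ x) (ψ z)
        linarith [hM x, hψM z]
      calc _ ≤ 2 * M := h2
        _ = 2 * M / min (ε ^ 2) 1 * min (ε ^ 2) 1 := by field_simp
        _ ≤ _ := by gcongr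
    · rw [indicator_of_notMem (by exact hz), abs_zero]; positivity
  have e1 : ∫ y, G y = c * ∫ z, {z : En n | ε ≤ ‖z‖}.indicator
      (fun z => φ x - φ (x + z)) z * fker n s z := by
    rw [← integral_add_left_eq_self G x, ← integral_const_mul]
    congr 1; ext z
    by_cases hz : ε ≤ ‖z‖
    · rw [indicator_of_mem (by exact hz), hG _ (by simpa using hz)]
      simp only [fker, sub_add_cancel_left, norm_neg]; ring
    · rw [indicator_of_notMem (by exact hz), hG' _ (by simpa using hz)]; simp
  have e2 : ∫ y, G y = c * ∫ z, {z : En n | ε ≤ ‖z‖}.indicator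
      (fun z => φ x - φ (x - z)) z * fker n s z := by
    rw [← integral_sub_left_eq_self G volume x, ← integral_const_mul]
    congr 1; ext z
    by_cases hz : ε ≤ ‖z‖
    · rw [indicator_of_mem (by exact hz), hG _ (by simpa using hz)]
      simp only [fker, sub_sub_cancel]; ring
    · rw [indicator_of_notMem (by exact hz), hG' _ (by simpa using hz)]; simp
  rw [← integral_indicator hSx]
  change ∫ y, G y = _
  have e3 : ∫ z, {z : En n | ε ≤ ‖z‖}.indicator (secDiff n φ x) z * fker n s z
      = (∫ z, {z : En n | ε ≤ ‖z‖}.indicator (fun z => φ x - φ (x + z)) z * fker n s z)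
        + ∫ z, {z : En n | ε ≤ ‖z‖}.indicator (fun z => φ x - φ (x - z)) z * fker n s z := by
    rw [← integral_add (key _ (by fun_prop) fun z => hM _) (key _ (by fun_prop) fun z => hM _)]
    congr 1; ext z
    by_cases hz : ε ≤ ‖z‖
    · simp only [indicator_of_mem (show z ∈ {z : En n | ε ≤ ‖z‖} from hz), secDiff]; ring
    · simp only [indicator_of_notMem (show z ∉ {z : En n | ε ≤ ‖z‖} from hz)]; ring
  rw [e3, mul_add]
  linarith

lemma fracLap_eq_fracSec {n : ℕ} (hn : 0 < n) {s : ℝ} (hs : s ∈ Ioo (0 : ℝ) 1)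
    {φ : En n → ℝ} (hφ : SmoothBdd n φ) (x : En n) : fracLap n s φ x = fracSec n s φ x := by
  obtain ⟨K, hK0, hK⟩ := exists_secDiff_bound hφ x
  have hK' := (hK x (by simp)).1
  obtain ⟨hsm, M, hM⟩ := hφ
  have hcont := hsm.continuous
  have hlim : Tendsto (fun ε : ℝ => ∫ z, {z : En n | ε ≤ ‖z‖}.indicator (secDiff n φ x) z
      * fker n s z) (nhdsWithin 0 (Ioi 0)) (nhds (∫ z, secDiff n φ x z * fker n s z)) := by
    refine tendsto_integral_filter_of_dominated_convergence
      (fun z => K * (min (‖z‖ ^ 2) 1 * fker n s z)) (Eventually.of_forall fun ε => ?_)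
      (Eventually.of_forall fun ε => Eventually.of_forall fun z => ?_)
      ((integral_min_sq_mul_fker hn hs).1.const_mul K) (Eventually.of_forall fun z => ?_)
    · exact ((secDiff_continuous hcont x).aestronglyMeasurable.indicator
        (measurableSet_le measurable_const measurable_norm)).mul
        (fker_measurable n s).aestronglyMeasurable
    · rw [Real.norm_eq_abs, abs_mul, abs_of_nonneg (fker_nonneg n s z), ← mul_assoc]
      refine mul_le_mul_of_nonneg_right (le_trans ?_ (hK' z)) (fker_nonneg n s z)
      rw [← Real.norm_eq_abs, ← Real.norm_eq_abs]
      exact norm_indicator_le_norm_self _ _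
    · by_cases hz : z = 0
      · have h0 : secDiff n φ x z = 0 := by simp [secDiff, hz]; ring
        have : ∀ ε : ℝ, {z : En n | ε ≤ ‖z‖}.indicator (secDiff n φ x) z = 0 := fun ε => by
          by_cases h : ε ≤ ‖z‖
          · rw [indicator_of_mem (by exact h), h0]
          · rw [indicator_of_notMem (by exact h)]
        simp only [this, h0]
        exact tendsto_const_nhds
      · have : ∀ᶠ ε : ℝ in nhdsWithin 0 (Ioi 0), ε < ‖z‖ :=
          nhdsWithin_le_nhds (eventually_lt_nhds (norm_pos_iff.2 hz))
        refine tendsto_const_nhds.congr' ?_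
        filter_upwards [this] with ε hε
        rw [indicator_of_mem (show z ∈ {z : En n | ε ≤ ‖z‖} from hε.le)]
  refine Tendsto.limUnder_eq ((hlim.const_mul (cns n s / 2)).congr' ?_)
  filter_upwards [self_mem_nhdsWithin] with ε hε
  exact (fracLap_truncated_eq hn hs hcont hM x hε).symm

lemma negLapInc_eq {n : ℕ} {φ : En n → ℝ} (hφ : ContDiff ℝ (⊤ : ℕ∞) φ) (x : En n) :
    negLapInc n φ x = -∑ i : Fin n, dd2 n (EuclideanSpace.single i 1) φ x := by
  rw [negLapInc, ← Finset.sum_neg_distrib]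
  exact (tendsto_finsetSum _ fun i _ =>
    tendsto_secDiff_div_sq hφ x (EuclideanSpace.single i 1)).liminf_eq

lemma stronglyMeasurable_integral_mul_fker {n : ℕ} {ψ : En n → ℝ} (hψ : Continuous ψ) :
    StronglyMeasurable fun s => ∫ z, ψ z * fker n s z := by
  refine StronglyMeasurable.integral_prod_right' (f := fun p : ℝ × En n => ψ p.2 * fker n p.1 p.2) ?_
  refine Measurable.stronglyMeasurable ?_
  have := hψ.measurable
  unfold fker
  fun_prop

lemma fracSec_aestronglyMeasurable {n : ℕ} (hn : 0 < n) (μ : Measure ℝ) {φ : En n → ℝ}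
    (hφ : Continuous φ) (x : En n) :
    AEStronglyMeasurable (fun s => fracSec n s φ x) (μ.restrict (Ioo 0 1)) := by
  have h1 : AEStronglyMeasurable (cns n) (μ.restrict (Ioo 0 1)) :=
    (cns_continuousOn hn).aestronglyMeasurable measurableSet_Ioo
  simp only [fracSec, div_eq_mul_inv]
  exact (h1.mul aestronglyMeasurable_const).mul
    (stronglyMeasurable_integral_mul_fker (secDiff_continuous hφ x)).aestronglyMeasurable

lemma exists_fracSec_bound {n : ℕ} (hn : 0 < n) : ∃ C : ℝ, 0 < C ∧ ∀ s ∈ Ioo (0 : ℝ) 1,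
    ∀ (φ : En n → ℝ) (x : En n) (K : ℝ), 0 ≤ K →
      (∀ z, |secDiff n φ x z| ≤ K * min (‖z‖ ^ 2) 1) → |fracSec n s φ x| ≤ C * K := by
  obtain ⟨c, C, hc, hC, h⟩ := exists_cnsReg_bounds hn
  have hv := sphVol_nonneg n
  refine ⟨C * (sphVol n + 1) / 4, by positivity, fun s hs φ x K hK hφ => ?_⟩
  have h1 := abs_integral_mul_fker_le hn hs hφ
  have hs0 := hs.1
  have hs1 : 0 < 1 - s := by linarith [hs.2]
  have h2 := (h s ⟨hs.1.le, hs.2.le⟩).2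
  have h3 := cnsReg_pos hn (s := s) ⟨hs.1.le, hs.2.le⟩
  rw [fracSec, abs_mul, cns_eq n hs.2, abs_of_pos (by positivity)]
  calc _ ≤ s * (1 - s) * cnsReg n s / 2 * (K * (sphVol n / (2 * (s * (1 - s))))) := by gcongr
    _ = cnsReg n s * (K * sphVol n / 4) := by field_simp; ring
    _ ≤ C * (K * sphVol n / 4) := by gcongr
    _ ≤ _ := by nlinarith [mul_nonneg hC.le hK]

lemma fracSec_integrableOn {n : ℕ} (hn : 0 < n) (μ : Measure ℝ) [IsProbabilityMeasure μ]
    {φ : En n → ℝ} (hφ : SmoothBdd n φ) (x : En n) :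
    IntegrableOn (fun s => fracSec n s φ x) (Ioo 0 1) μ := by
  obtain ⟨C, hC, h⟩ := exists_fracSec_bound hn
  obtain ⟨K, hK0, hK⟩ := exists_secDiff_bound hφ x
  refine Integrable.mono' (g := fun _ => C * K) (integrable_const _)
    (fracSec_aestronglyMeasurable hn μ hφ.1.continuous x) ?_
  exact (ae_restrict_iff' measurableSet_Ioo).2 (Eventually.of_forall fun s hs =>
    h s hs φ x K hK0 (hK x (by simp)).1)

lemma opMu_eq {n : ℕ} (hn : 0 < n) {μ : Measure ℝ} [IsProbabilityMeasure μ]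
    (hμ : μ (Icc 0 1) = 1) {φ : En n → ℝ} (hφ : SmoothBdd n φ) (x : En n) :
    opMu n μ φ x = μ.real {0} * φ x + opPos n μ φ x := by
  have hE : EqOn (fun s => fracLapE n s φ x) (fun s => fracSec n s φ x) (Ioo 0 1) := by
    intro s hs
    simp only [fracLapE, if_neg hs.1.ne', if_neg hs.2.ne]
    exact fracLap_eq_fracSec hn hs hφ x
  have i1 : IntegrableOn (fun s => fracLapE n s φ x) (Ioo 0 1) μ :=
    (fracSec_integrableOn hn μ hφ x).congr_fun hE.symm measurableSet_Ioo
  have i2 : ∀ a : ℝ, IntegrableOn (fun s => fracLapE n s φ x) {a} μ := fun a =>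
    integrableOn_singleton (by simp)
  have hr : μ.restrict (Icc 0 1) = μ := by
    refine Measure.restrict_eq_self_of_ae_mem ?_
    have := (prob_compl_eq_zero_iff (μ := μ) (measurableSet_Icc (a := (0 : ℝ)) (b := 1))).2 hμ
    exact mem_ae_iff.2 this
  have hu : Icc (0 : ℝ) 1 = {0} ∪ (Ioo 0 1 ∪ {1}) := by
    rw [Ioo_union_right one_pos, ← Ioc_union_left zero_le_one, union_comm]
  rw [opMu, opPos]
  nth_rewrite 1 [← hr]
  rw [hu, setIntegral_union (by simp) (measurableSet_Ioo.union (measurableSet_singleton 1)) (i2 0) (i1.union (i2 1)),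
    setIntegral_union (by simp) (measurableSet_singleton 1) i1 (i2 1), integral_singleton,
    integral_singleton, setIntegral_congr_fun measurableSet_Ioo hE]
  simp [fracLapE, negLapInc_eq hφ.1]

/-! ### Differentiation of the operators along lines -/

lemma dd_comm {n : ℕ} {φ : En n → ℝ} (hφ : ContDiff ℝ (⊤ : ℕ∞) φ) (e v : En n) :
    dd n e (dd n v φ) = dd n v (dd n e φ) := by
  ext z
  rw [dd_dd_eq hφ, dd_dd_eq hφ]
  have h : IsSymmSndFDerivAt ℝ φ z := hφ.contDiffAt.isSymmSndFDerivAt (by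
    rw [minSmoothness_of_isRCLikeNormedField]; exact WithTop.coe_le_coe.2 le_top)
  exact h e v

lemma hasDerivAt_secDiff {n : ℕ} {φ : En n → ℝ} (hφ : ContDiff ℝ (⊤ : ℕ∞) φ) (x e z : En n)
    (t : ℝ) : HasDerivAt (fun t : ℝ => secDiff n φ (x + t • e) z)
      (secDiff n (dd n e φ) (x + t • e) z) t := by
  have h1 := hasDerivAt_line hφ x e t
  have h2 := hasDerivAt_line hφ (x + z) e t
  have h3 := hasDerivAt_line hφ (x - z) e t
  simp only [secDiff]
  simp only [add_right_comm x z, sub_add_eq_add_sub] at h2 h3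
  exact ((h1.const_mul 2).sub h2).sub h3

lemma norm_line_sub_le {n : ℕ} {e : En n} (he : ‖e‖ = 1) (x : En n) {t t₀ : ℝ}
    (ht : t ∈ ball t₀ 1) : ‖x + t • e - (x + t₀ • e)‖ ≤ 1 := by
  have : x + t • e - (x + t₀ • e) = (t - t₀) • e := by module
  rw [this, norm_smul, he, mul_one]
  rw [mem_ball, dist_eq_norm] at ht
  exact ht.le

lemma hasDerivAt_fracSec {n : ℕ} (hn : 0 < n) {s : ℝ} (hs : s ∈ Ioo (0 : ℝ) 1) {φ : En n → ℝ}
    {e : En n} (he : ‖e‖ = 1) (hφ : SmoothBdd n φ) (hφ' : SmoothBdd n (dd n e φ)) (x : En n)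
    (t₀ : ℝ) : HasDerivAt (fun t : ℝ => fracSec n s φ (x + t • e))
      (fracSec n s (dd n e φ) (x + t₀ • e)) t₀ := by
  obtain ⟨K, hK0, hK⟩ := exists_secDiff_bound hφ (x + t₀ • e)
  obtain ⟨K', hK0', hK'⟩ := exists_secDiff_bound hφ' (x + t₀ • e)
  have hm : ∀ (ψ : En n → ℝ) (y : En n), SmoothBdd n ψ →
      AEStronglyMeasurable fun z => secDiff n ψ y z * fker n s z := fun ψ y hψ =>
    (secDiff_continuous hψ.1.continuous y).aestronglyMeasurable.mul
      (fker_measurable n s).aestronglyMeasurable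
  have h := hasDerivAt_integral_of_dominated_loc_of_deriv_le (μ := (volume : Measure (En n)))
    (F := fun t z => secDiff n φ (x + t • e) z * fker n s z)
    (F' := fun t z => secDiff n (dd n e φ) (x + t • e) z * fker n s z)
    (x₀ := t₀) (s := ball t₀ 1) (bound := fun z => K' * (min (‖z‖ ^ 2) 1 * fker n s z))
    (ball_mem_nhds t₀ one_pos) (Eventually.of_forall fun t => hm φ _ hφ)
    (integrable_mul_fker_of_le hn hs
      (secDiff_continuous hφ.1.continuous _).aestronglyMeasurable (hK _ (by simp)).1)
    (hm _ _ hφ')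
    (Eventually.of_forall fun z t ht => by
      rw [Real.norm_eq_abs, abs_mul, abs_of_nonneg (fker_nonneg n s z), ← mul_assoc]
      exact mul_le_mul_of_nonneg_right ((hK' _ (norm_line_sub_le he x ht)).1 z)
        (fker_nonneg n s z))
    ((integral_min_sq_mul_fker hn hs).1.const_mul K')
    (Eventually.of_forall fun z t _ => (hasDerivAt_secDiff hφ.1 x e z t).mul_const _)
  exact h.2.const_mul _

lemma hasDerivAt_opPos {n : ℕ} (hn : 0 < n) (μ : Measure ℝ) [IsProbabilityMeasure μ]
    {φ : En n → ℝ} {e : En n} (he : ‖e‖ = 1) (hφ : SmoothBdd n φ)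
    (hφ' : SmoothBdd n (dd n e φ)) (x : En n) (t₀ : ℝ) :
    HasDerivAt (fun t : ℝ => opPos n μ φ (x + t • e)) (opPos n μ (dd n e φ) (x + t₀ • e)) t₀ := by
  obtain ⟨C, hC, hCb⟩ := exists_fracSec_bound hn
  obtain ⟨K', hK0', hK'⟩ := exists_secDiff_bound hφ' (x + t₀ • e)
  have h := hasDerivAt_integral_of_dominated_loc_of_deriv_le (μ := μ.restrict (Ioo 0 1))
    (F := fun t s => fracSec n s φ (x + t • e))
    (F' := fun t s => fracSec n s (dd n e φ) (x + t • e))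
    (x₀ := t₀) (s := ball t₀ 1) (bound := fun _ => C * K')
    (ball_mem_nhds t₀ one_pos)
    (Eventually.of_forall fun t => fracSec_aestronglyMeasurable hn μ hφ.1.continuous _)
    (fracSec_integrableOn hn μ hφ _)
    (fracSec_aestronglyMeasurable hn μ hφ'.1.continuous _)
    ((ae_restrict_iff' measurableSet_Ioo).2 (Eventually.of_forall fun s hs t ht =>
      hCb s hs _ _ K' hK0' (hK' _ (norm_line_sub_le he x ht)).1))
    (integrable_const _)
    ((ae_restrict_iff' measurableSet_Ioo).2 (Eventually.of_forall fun s hs t _ =>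
      hasDerivAt_fracSec hn hs he hφ hφ' x t))
  have h2 : HasDerivAt
      (fun t : ℝ => ∑ i : Fin n, dd2 n (EuclideanSpace.single i 1) φ (x + t • e))
      (∑ i : Fin n, dd2 n (EuclideanSpace.single i 1) (dd n e φ) (x + t₀ • e)) t₀ := by
    refine HasDerivAt.fun_sum fun i _ => ?_
    set v : En n := EuclideanSpace.single i 1
    have h3 := hasDerivAt_line (dd_contDiff (dd_contDiff hφ.1 v) v) x e t₀
    have h4 : dd n e (dd n v (dd n v φ)) = dd2 n v (dd n e φ) := by
      rw [dd_comm (dd_contDiff hφ.1 v), dd_comm hφ.1]; rfl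
    rw [h4] at h3
    exact h3
  exact h.2.add (h2.neg.const_mul _)

lemma opPos_sub_const {n : ℕ} (μ : Measure ℝ) (φ : En n → ℝ) (c : ℝ) :
    opPos n μ (fun y => φ y - c) = opPos n μ φ := by
  have h : ∀ e : En n, dd n e (fun y => φ y - c) = dd n e φ := fun e => by
    ext z; simp only [dd, fderiv_sub_const]
  have h' : ∀ x, secDiff n (fun y => φ y - c) x = secDiff n φ x := fun x => by
    ext z; simp only [secDiff]; ring
  ext x
  simp only [opPos, fracSec, dd2, h, h']

lemma SmoothBdd.sub_const {n : ℕ} {φ : En n → ℝ} (hφ : SmoothBdd n φ) (c : ℝ) :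
    SmoothBdd n fun y => φ y - c := by
  obtain ⟨h, M, hM⟩ := hφ
  exact ⟨h.sub contDiff_const, M + |c|, fun y => (abs_sub _ _).trans (by gcongr; exact hM y)⟩

/-! ### Lower bounds for the operators in terms of averages -/

lemma avg_sub_eq_secDiff {n : ℕ} {φ : En n → ℝ} (hφ : Continuous φ) (r : ℝ) (x : En n) :
    ∫ z, secDiff n φ x (r • z) * moll n z = 2 * (φ x - avg n r φ x) := by
  have h := integral_mul_moll_neg (n := n) (fun z => φ (x + r • z))
  have i1 := integrable_avg hφ r x
  have i2 := integrable_mul_moll (n := n) (ψ := fun z => φ (x + r • (-z))) (by fun_prop)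
  have i3 := integrable_mul_moll (n := n) (ψ := fun _ => 2 * φ x) (by fun_prop)
  have e : ∀ z, secDiff n φ x (r • z) * moll n z = 2 * φ x * moll n z
      - φ (x + r • z) * moll n z - φ (x + r • (-z)) * moll n z := fun z => by
    rw [smul_neg, ← sub_eq_add_neg, secDiff]; ring
  simp only [e]
  have i4 : Integrable fun z => 2 * φ x * moll n z - φ (x + r • z) * moll n z := i3.sub i1
  rw [integral_sub i4 i2, integral_sub i3 i1, h, integral_const_mul_moll, avg]
  ring

lemma exists_moll_bound (n : ℕ) : ∃ M : ℝ, 0 < M ∧ ∀ z, moll n z ≤ M := by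
  obtain ⟨M, hM⟩ := (moll_continuous n).bounded_above_of_compact_support (moll_hasCompactSupport n)
  exact ⟨|M| + 1, by positivity, fun z => by
    linarith [(le_abs_self _).trans (hM z), le_abs_self M]⟩

/-- Integrating the mollifier over all scales produces the homogeneous kernel. -/
lemma integral_scale_moll {n : ℕ} (hn : 0 < n) {M : ℝ} (hM : ∀ z, moll n z ≤ M) {s : ℝ}
    (hs : 0 < s) : ∃ k : ℝ, 0 ≤ k ∧ k ≤ M ∧ ∀ y : En n, y ≠ 0 →
      IntegrableOn (fun r : ℝ => r ^ (-1 - 2 * s - n) * moll n (r⁻¹ • y)) (Ioi 0) ∧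
      ∫ r in Ioi (0 : ℝ), r ^ (-1 - 2 * s - n) * moll n (r⁻¹ • y) = k * fker n s y := by
  have hn1 : (1 : ℝ) ≤ n := by exact_mod_cast hn
  set e : En n := EuclideanSpace.single ⟨0, hn⟩ 1
  have he : ‖e‖ = 1 := by simp [e]
  have hM0 : 0 ≤ M := (moll_nonneg n 0).trans (hM 0)
  set h : ℝ → ℝ := fun ρ => ρ ^ (-1 - 2 * s - n) * moll n (ρ⁻¹ • e)
  have hmeas : Measurable h := by
    have := (moll_continuous n).measurable
    simp only [h]
    fun_prop
  have hnn : ∀ ρ ∈ Ioi (0 : ℝ), 0 ≤ h ρ := fun ρ hρ =>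
    mul_nonneg (Real.rpow_nonneg (le_of_lt hρ) _) (moll_nonneg n _)
  have hU : Ioi (0 : ℝ) = Ioc 0 1 ∪ Ioi 1 := (Ioc_union_Ioi_eq_Ioi zero_le_one).symm
  have hd : Disjoint (Ioc (0 : ℝ) 1) (Ioi 1) := by
    rw [Set.disjoint_left]; intro y hy hy'; exact absurd hy.2 (not_le.2 hy')
  have h0 : EqOn (fun _ : ℝ => (0 : ℝ)) h (Ioc 0 1) := by
    intro ρ hρ
    have : 1 ≤ ‖ρ⁻¹ • e‖ := by
      rw [norm_smul, he, mul_one, norm_inv, Real.norm_eq_abs, abs_of_pos hρ.1]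
      exact (one_le_inv₀ hρ.1).2 hρ.2
    simp only [h, moll_zero_of_one_le n this, mul_zero]
  have i0 : IntegrableOn h (Ioc 0 1) := integrableOn_zero.congr_fun h0 measurableSet_Ioc
  have ib : IntegrableOn (fun ρ : ℝ => M * ρ ^ (-1 - 2 * s - n)) (Ioi 1) :=
    (integrableOn_Ioi_rpow_of_lt (by linarith) one_pos).const_mul M
  have hle : ∀ ρ ∈ Ioi (1 : ℝ), h ρ ≤ M * ρ ^ (-1 - 2 * s - n) := fun ρ hρ => by
    have hρ0 : (0 : ℝ) ≤ ρ := zero_le_one.trans (le_of_lt hρ)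
    rw [mul_comm M]
    exact mul_le_mul_of_nonneg_left (hM _) (Real.rpow_nonneg hρ0 _)
  have i1 : IntegrableOn h (Ioi 1) := by
    refine Integrable.mono' ib hmeas.aestronglyMeasurable
      ((ae_restrict_iff' measurableSet_Ioi).2 (Eventually.of_forall fun ρ hρ => ?_))
    rw [Real.norm_eq_abs, abs_of_nonneg (hnn ρ (show (0 : ℝ) < ρ from lt_trans one_pos (show (1 : ℝ) < ρ from hρ)))]
    exact hle ρ hρ
  have ih : IntegrableOn h (Ioi 0) := by rw [hU]; exact i0.union i1
  refine ⟨∫ ρ in Ioi (0 : ℝ), h ρ, setIntegral_nonneg measurableSet_Ioi hnn, ?_, fun y hy => ?_⟩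
  · rw [hU, setIntegral_union hd measurableSet_Ioi i0 i1,
      ← setIntegral_congr_fun measurableSet_Ioc h0, integral_zero, zero_add]
    refine (setIntegral_mono_on i1 ib measurableSet_Ioi hle).trans ?_
    rw [integral_const_mul, integral_Ioi_rpow_of_lt (by linarith) one_pos, Real.one_rpow]
    have : (-1 : ℝ) / (-1 - 2 * s - n + 1) ≤ 1 := by
      rw [div_le_one_of_neg (by linarith)]; linarith
    nlinarith
  · have hy' : 0 < ‖y‖ := norm_pos_iff.2 hy
    have hc : EqOn (fun ρ : ℝ => ‖y‖ ^ (-1 - 2 * s - n) * h ρ)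
        (fun ρ : ℝ => (fun r : ℝ => r ^ (-1 - 2 * s - n) * moll n (r⁻¹ • y)) (‖y‖ * ρ))
        (Ioi 0) := by
      intro ρ hρ
      have hρ0 : (0 : ℝ) < ρ := hρ
      have e1 : moll n (ρ⁻¹ • e) = moll n ((‖y‖ * ρ)⁻¹ • y) := by
        refine moll_congr_norm n ?_
        rw [norm_smul, norm_smul, he, norm_inv, norm_inv, norm_mul, norm_norm]
        field_simp
      simp only [h]
      rw [e1, Real.mul_rpow hy'.le hρ0.le, mul_assoc]
    have i2 := IntegrableOn.congr_fun (ih.const_mul (‖y‖ ^ (-1 - 2 * s - n))) hc measurableSet_Ioi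
    have i3 := (integrableOn_Ioi_comp_mul_left_iff
      (fun r : ℝ => r ^ (-1 - 2 * s - n) * moll n (r⁻¹ • y)) 0 hy').1 i2
    rw [mul_zero] at i3
    refine ⟨i3, ?_⟩
    have e2 := integral_comp_mul_left_Ioi
      (fun r : ℝ => r ^ (-1 - 2 * s - n) * moll n (r⁻¹ • y)) 0 hy'
    rw [mul_zero, ← setIntegral_congr_fun measurableSet_Ioi hc, integral_const_mul,
      smul_eq_mul] at e2
    have e3 : fker n s y = ‖y‖ * ‖y‖ ^ (-1 - 2 * s - n) := by
      nth_rewrite 1 [← Real.rpow_one ‖y‖]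
      rw [← Real.rpow_add hy', fker]; congr 1; ring
    rw [e3]
    rw [eq_inv_mul_iff_mul_eq₀ hy'.ne'] at e2
    linarith

lemma integral_mul_fker_ge {n : ℕ} (hn : 0 < n) {M : ℝ} (hM : ∀ z, moll n z ≤ M) {s : ℝ}
    (hs : s ∈ Ioo (0 : ℝ) 1) {G : En n → ℝ} (hG : Continuous G) {K : ℝ}
    (hK : ∀ z, |G z| ≤ K * min (‖z‖ ^ 2) 1) {β : ℝ} (hβ : 0 < β)
    (h : ∀ r, 0 < r → 2 * (β * min (r ^ 2) 1) ≤ ∫ z, G (r • z) * moll n z) :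
    β / (s * (1 - s)) ≤ M * ∫ z, G z * fker n s z := by
  obtain ⟨k, hk0, hkM, hk⟩ := integral_scale_moll hn hM hs.1
  have hs0 := hs.1
  have hs1 : 0 < 1 - s := by linarith [hs.2]
  have hG0 : G 0 = 0 := by simpa using hK 0
  set H : ℝ → En n → ℝ := fun r y => r ^ (-1 - 2 * s - n) * (G y * moll n (r⁻¹ • y))
  have hHy : ∀ y, (fun r => H r y) = fun r => G y * (r ^ (-1 - 2 * s - n) * moll n (r⁻¹ • y)) :=
    fun y => by ext r; simp only [H]; ring
  have hGk : Integrable fun z => G z * fker n s z :=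
    integrable_mul_fker_of_le hn hs hG.aestronglyMeasurable hK
  have hprod : Integrable (Function.uncurry H) ((volume.restrict (Ioi 0)).prod volume) := by
    have hmeas : Measurable (Function.uncurry H) := by
      have := (moll_continuous n).measurable
      have := hG.measurable
      simp only [H, Function.uncurry_def]
      fun_prop
    rw [integrable_prod_iff' hmeas.aestronglyMeasurable]
    constructor
    · refine Eventually.of_forall fun y => ?_
      simp only [Function.uncurry_apply_pair]
      rw [hHy]
      by_cases hy : y = 0
      · simp [hy, hG0]
      · exact (hk y hy).1.const_mul _
    · refine (hGk.norm.const_mul k).congr (Eventually.of_forall fun y => ?_)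
      simp only [Function.uncurry_apply_pair]
      have e1 : ∫ r in Ioi (0 : ℝ), ‖H r y‖
          = ∫ r in Ioi (0 : ℝ), |G y| * (r ^ (-1 - 2 * s - n) * moll n (r⁻¹ • y)) := by
        refine setIntegral_congr_fun measurableSet_Ioi fun r hr => ?_
        have : H r y = G y * (r ^ (-1 - 2 * s - n) * moll n (r⁻¹ • y)) := congrFun (hHy y) r
        change ‖H r y‖ = _
        rw [this, Real.norm_eq_abs, abs_mul, abs_of_nonneg
          (mul_nonneg (Real.rpow_nonneg (le_of_lt hr) _) (moll_nonneg n _))]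
      rw [e1, integral_const_mul, Real.norm_eq_abs, abs_mul, abs_of_nonneg (fker_nonneg n s y)]
      by_cases hy : y = 0
      · simp [hy, hG0]
      · rw [(hk y hy).2]; ring
  have hswap := integral_integral_swap hprod
  have hL : ∀ r ∈ Ioi (0 : ℝ), ∫ y, H r y = r ^ (-1 - 2 * s) * ∫ z, G (r • z) * moll n z := by
    intro r hr
    have hr0 : (0 : ℝ) < r := hr
    have e1 := Measure.integral_comp_smul (volume : Measure (En n))
      (fun y => G y * moll n (r⁻¹ • y)) r
    simp only [inv_smul_smul₀ hr0.ne', finrank_euclideanSpace, Fintype.card_fin, smul_eq_mul] at e1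
    rw [e1, abs_of_pos (by positivity)]
    simp only [H]
    rw [integral_const_mul, Real.rpow_sub hr0, Real.rpow_natCast]
    field_simp
  have hR : ∀ y, ∫ r in Ioi (0 : ℝ), H r y = k * (G y * fker n s y) := by
    intro y
    rw [hHy, integral_const_mul]
    by_cases hy : y = 0
    · simp [hy, hG0]
    · rw [(hk y hy).2]; ring
  simp only [hR] at hswap
  rw [integral_const_mul] at hswap
  have hI := hprod.integral_prod_left
  have hge : ∫ r in Ioi (0 : ℝ), 2 * β * (min (r ^ 2) 1 * r ^ (-1 - 2 * s))
      ≤ ∫ r in Ioi (0 : ℝ), ∫ y, H r y := by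
    refine setIntegral_mono_on ((integral_min_sq_mul_rpow hs).1.const_mul _) hI measurableSet_Ioi
      fun r hr => ?_
    rw [hL r hr]
    have h1 := mul_le_mul_of_nonneg_left (h r hr) (Real.rpow_nonneg (le_of_lt hr) (-1 - 2 * s))
    linarith
  rw [integral_const_mul, (integral_min_sq_mul_rpow hs).2, hswap] at hge
  have e : 2 * β * (1 / (2 * (s * (1 - s)))) = β / (s * (1 - s)) := by field_simp
  rw [e] at hge
  have hpos : 0 < β / (s * (1 - s)) := by positivity
  have hint : 0 ≤ ∫ z, G z * fker n s z := by
    by_contra hneg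
    nlinarith
  exact hge.trans (mul_le_mul_of_nonneg_right hkM hint)

lemma integral_inner_sq_mul_moll_congr {n : ℕ} {v w : En n} (h : ‖v‖ = ‖w‖) :
    ∫ z, inner ℝ v z ^ 2 * moll n z = ∫ z, inner ℝ w z ^ 2 * moll n z := by
  set T := (ℝ ∙ (v - w))ᗮ.reflection
  have hT : T v = w := Submodule.reflection_sub h
  have h1 := T.measurePreserving.integral_comp T.toHomeomorph.measurableEmbedding
    (fun z => inner ℝ w z ^ 2 * moll n z)
  rw [← h1]
  congr 1; ext z
  rw [← hT, T.inner_map_map, moll_congr_norm n (T.norm_map z)]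

lemma integral_inner_mul_inner_mul_moll {n : ℕ} {v w : En n} (h : ‖v + w‖ = ‖v - w‖) :
    ∫ z, inner ℝ v z * inner ℝ w z * moll n z = 0 := by
  have h1 := integral_inner_sq_mul_moll_congr h
  have i : ∀ a : En n, Integrable fun z => inner ℝ a z ^ 2 * moll n z := fun a =>
    integrable_mul_moll (by fun_prop)
  have e : ∀ z, inner ℝ v z * inner ℝ w z * moll n z = (1 / 4) *
      (inner ℝ (v + w) z ^ 2 * moll n z - inner ℝ (v - w) z ^ 2 * moll n z) := fun z => by
    rw [inner_add_left, inner_sub_left]; ring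
  simp only [e]
  rw [integral_const_mul, integral_sub (i _) (i _), h1, sub_self, mul_zero]

lemma integral_coord_mul_moll {n : ℕ} (i j : Fin n) :
    ∫ z : En n, z i * z j * moll n z = if i = j then moment n / n else 0 := by
  have hin : ∀ (k : Fin n) (z : En n), inner ℝ (EuclideanSpace.single k (1 : ℝ)) z = z k :=
    fun k z => by simp [EuclideanSpace.inner_single_left]
  by_cases hij : i = j
  · subst hij
    rw [if_pos rfl]
    have h1 : ∀ k : Fin n, ∫ z : En n, z k ^ 2 * moll n z = ∫ z : En n, z i ^ 2 * moll n z := by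
      intro k
      have := integral_inner_sq_mul_moll_congr (n := n) (v := EuclideanSpace.single k (1 : ℝ))
        (w := EuclideanSpace.single i (1 : ℝ)) (by simp)
      simpa only [hin] using this
    have h2 : moment n = ∑ k : Fin n, ∫ z : En n, z k ^ 2 * moll n z := by
      rw [← integral_finsetSum _ fun k _ => integrable_mul_moll (by fun_prop), moment]
      congr 1; ext z
      rw [EuclideanSpace.real_norm_sq_eq, Finset.sum_mul]
    rw [Finset.sum_congr rfl fun k _ => h1 k, Finset.sum_const, Finset.card_univ,
      Fintype.card_fin, nsmul_eq_mul] at h2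
    have hn : (n : ℝ) ≠ 0 := by exact_mod_cast (Fin.pos i).ne'
    simp only [← sq]
    rw [h2]; field_simp
  · rw [if_neg hij]
    have := integral_inner_mul_inner_mul_moll (n := n) (v := EuclideanSpace.single i (1 : ℝ))
      (w := EuclideanSpace.single j (1 : ℝ)) (by
        have h0 : inner ℝ (EuclideanSpace.single i (1 : ℝ)) (EuclideanSpace.single j (1 : ℝ)) = 0 := by
          rw [hin]; simp [hij]
        rw [← sq_eq_sq₀ (norm_nonneg _) (norm_nonneg _), @norm_add_sq_real, @norm_sub_sq_real, h0]
        ring)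
    simpa only [hin] using this

lemma integral_dd_dd_mul_moll {n : ℕ} {φ : En n → ℝ} (hφ : ContDiff ℝ (⊤ : ℕ∞) φ) (x : En n) :
    ∫ z, dd n z (dd n z φ) x * moll n z
      = moment n / n * ∑ i : Fin n, dd2 n (EuclideanSpace.single i 1) φ x := by
  set B := fderiv ℝ (fderiv ℝ φ) x
  set e : Fin n → En n := fun i => EuclideanSpace.single i 1
  have hB : ∀ z, dd n z (dd n z φ) x = ∑ i, ∑ j, z i * z j * B (e i) (e j) := by
    intro z
    rw [dd_dd_eq hφ]
    have hz : z = ∑ i, z i • e i := by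
      simpa [e] using ((EuclideanSpace.basisFun (Fin n) ℝ).sum_repr z).symm
    conv_lhs => rw [hz]
    simp only [map_sum, map_smul, sum_apply, smul_apply,
      smul_eq_mul, Finset.mul_sum]
    rw [Finset.sum_comm]
    exact Finset.sum_congr rfl fun i _ => Finset.sum_congr rfl fun j _ => by ring
  have hi : ∀ i j : Fin n, Integrable fun z : En n => z i * z j * B (e i) (e j) * moll n z :=
    fun i j => integrable_mul_moll (by fun_prop)
  simp only [hB, Finset.sum_mul]
  rw [integral_finsetSum _ fun i _ => integrable_finsetSum _ fun j _ => hi i j, Finset.mul_sum]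
  refine Finset.sum_congr rfl fun i _ => ?_
  rw [integral_finsetSum _ fun j _ => hi i j]
  have e1 : ∀ j, ∫ z : En n, z i * z j * B (e i) (e j) * moll n z
      = (if i = j then moment n / n else 0) * B (e i) (e j) := by
    intro j
    rw [← integral_coord_mul_moll, ← integral_mul_const]
    congr 1; ext z; ring
  simp only [e1, ite_mul, zero_mul, Finset.sum_ite_eq, Finset.mem_univ, if_true]
  congr 1
  exact (dd_dd_eq hφ (e i) (e i) x).symm

lemma tendsto_avg_sub_div_sq {n : ℕ} {φ : En n → ℝ} (hφ : SmoothBdd n φ) (x : En n) :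
    Tendsto (fun r : ℝ => (φ x - avg n r φ x) / r ^ 2) (nhdsWithin 0 (Ioi 0))
      (nhds (moment n / (2 * n) * (-∑ i : Fin n, dd2 n (EuclideanSpace.single i 1) φ x))) := by
  obtain ⟨K, hK0, hK⟩ := exists_secDiff_bound hφ x
  have hK' := (hK x (by simp)).1
  have hlim : Tendsto (fun r : ℝ => ∫ z, secDiff n φ x (r • z) / r ^ 2 * moll n z)
      (nhdsWithin 0 (Ioi 0)) (nhds (∫ z, -dd n z (dd n z φ) x * moll n z)) := by
    refine tendsto_integral_filter_of_dominated_convergence (fun z => K * ‖z‖ ^ 2 * moll n z)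
      (Eventually.of_forall fun r => ?_) ?_ (integrable_mul_moll (by fun_prop))
      (Eventually.of_forall fun z => (tendsto_secDiff_div_sq hφ.1 x z).mul_const _)
    · have := secDiff_continuous hφ.1.continuous x
      have := moll_continuous n
      exact Continuous.aestronglyMeasurable (by fun_prop)
    · filter_upwards [self_mem_nhdsWithin] with r hr
      have hr0 : (0 : ℝ) < r := hr
      refine Eventually.of_forall fun z => ?_
      rw [Real.norm_eq_abs, abs_mul, abs_of_nonneg (moll_nonneg n z), abs_div,
        abs_of_pos (show 0 < r ^ 2 by positivity)]
      refine mul_le_mul_of_nonneg_right ?_ (moll_nonneg n z)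
      rw [div_le_iff₀ (by positivity)]
      refine (hK' _).trans ?_
      rw [norm_smul, Real.norm_eq_abs, abs_of_pos hr0, mul_assoc]
      refine mul_le_mul_of_nonneg_left ((min_le_left _ _).trans (le_of_eq ?_)) hK0
      ring
  have e1 : ∫ z, -dd n z (dd n z φ) x * moll n z
      = 2 * (moment n / (2 * n) * (-∑ i : Fin n, dd2 n (EuclideanSpace.single i 1) φ x)) := by
    simp only [neg_mul, integral_neg, integral_dd_dd_mul_moll hφ.1]
    ring
  rw [e1] at hlim
  have h2 := hlim.const_mul (1 / 2)
  refine (h2.congr fun r => ?_).trans (le_of_eq ?_)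
  · have e2 : ∀ z, secDiff n φ x (r • z) / r ^ 2 * moll n z
        = (1 / r ^ 2) * (secDiff n φ x (r • z) * moll n z) := fun z => by ring
    simp only [e2]
    rw [integral_const_mul, avg_sub_eq_secDiff hφ.1.continuous]
    ring
  · congr 1; ring

lemma exists_opPos_lower {n : ℕ} (hn : 0 < n) : ∃ c₀ : ℝ, 0 < c₀ ∧
    ∀ (μ : Measure ℝ), IsProbabilityMeasure μ → μ (Icc 0 1) = 1 →
    ∀ (φ ψ : En n → ℝ), SmoothBdd n φ → SmoothBdd n ψ → ∀ (x : En n) (p q β : ℝ), 0 < β →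
      (∀ r, 0 < r → β * min (r ^ 2) 1 ≤ p * (φ x - avg n r φ x) + q * (ψ x - avg n r ψ x)) →
      c₀ * β * (1 - μ.real {0}) ≤ p * opPos n μ φ x + q * opPos n μ ψ x := by
  obtain ⟨c, C, hc, -, hcb⟩ := exists_cnsReg_bounds hn
  obtain ⟨M, hM0, hM⟩ := exists_moll_bound n
  refine ⟨min (c / (2 * M)) 1, lt_min (by positivity) one_pos, ?_⟩
  set c₀ := min (c / (2 * M)) 1
  have hc₀ : 0 < c₀ := lt_min (by positivity) one_pos
  intro μ _ hμ φ ψ hφ hψ x p q β hβ h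
  obtain ⟨K, hK0, hK⟩ := exists_secDiff_bound hφ x
  obtain ⟨K', hK0', hK'⟩ := exists_secDiff_bound hψ x
  replace hK := (hK x (by simp)).1
  replace hK' := (hK' x (by simp)).1
  have h1 : ∀ s ∈ Ioo (0 : ℝ) 1, c₀ * β ≤ p * fracSec n s φ x + q * fracSec n s ψ x := by
    intro s hs
    have hs0 := hs.1
    have hs1 : 0 < 1 - s := by linarith [hs.2]
    have i1 := integrable_mul_fker_of_le hn hs
      (secDiff_continuous hφ.1.continuous x).aestronglyMeasurable hK
    have i2 := integrable_mul_fker_of_le hn hs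
      (secDiff_continuous hψ.1.continuous x).aestronglyMeasurable hK'
    have hGc : Continuous fun z => p * secDiff n φ x z + q * secDiff n ψ x z :=
      ((secDiff_continuous hφ.1.continuous x).const_mul p).add
        ((secDiff_continuous hψ.1.continuous x).const_mul q)
    have h2 := integral_mul_fker_ge hn hM hs hGc (K := |p| * K + |q| * K') (fun z => by
      refine (abs_add_le _ _).trans ?_
      rw [abs_mul, abs_mul, add_mul, mul_assoc, mul_assoc]
      have := hK z
      have := hK' z
      gcongr) hβ (fun r hr => by
      have e : ∀ z, (p * secDiff n φ x (r • z) + q * secDiff n ψ x (r • z)) * moll n z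
          = p * (secDiff n φ x (r • z) * moll n z) + q * (secDiff n ψ x (r • z) * moll n z) :=
        fun z => by ring
      have hc1 := secDiff_continuous hφ.1.continuous x
      have hc2 := secDiff_continuous hψ.1.continuous x
      simp only [e]
      rw [integral_add ((integrable_mul_moll (by fun_prop)).const_mul p)
        ((integrable_mul_moll (by fun_prop)).const_mul q), integral_const_mul,
        integral_const_mul, avg_sub_eq_secDiff hφ.1.continuous,
        avg_sub_eq_secDiff hψ.1.continuous]
      linarith [h r hr])
    have e2 : ∫ z, (p * secDiff n φ x z + q * secDiff n ψ x z) * fker n s z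
        = p * (∫ z, secDiff n φ x z * fker n s z) + q * ∫ z, secDiff n ψ x z * fker n s z := by
      rw [← integral_const_mul, ← integral_const_mul, ← integral_add (i1.const_mul p)
        (i2.const_mul q)]
      congr 1; ext z; ring
    rw [e2] at h2
    set I := p * (∫ z, secDiff n φ x z * fker n s z) + q * ∫ z, secDiff n ψ x z * fker n s z
    have e3 : p * fracSec n s φ x + q * fracSec n s ψ x = s * (1 - s) * cnsReg n s / 2 * I := by
      simp only [fracSec, cns_eq n hs.2, I]; ring
    rw [e3]
    have h3 := (hcb s ⟨hs.1.le, hs.2.le⟩).1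
    calc c₀ * β ≤ c / (2 * M) * β := by gcongr; exact min_le_left _ _
      _ ≤ cnsReg n s / (2 * M) * β := by gcongr
      _ = s * (1 - s) * cnsReg n s / (2 * M) * (β / (s * (1 - s))) := by field_simp
      _ ≤ s * (1 - s) * cnsReg n s / (2 * M) * (M * I) := by
        have := cnsReg_pos hn (s := s) ⟨hs.1.le, hs.2.le⟩
        gcongr
      _ = _ := by field_simp
  have h2 : c₀ * β ≤ p * (-∑ i : Fin n, dd2 n (EuclideanSpace.single i 1) φ x)
      + q * (-∑ i : Fin n, dd2 n (EuclideanSpace.single i 1) ψ x) := by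
    have hl := ((tendsto_avg_sub_div_sq hφ x).const_mul p).add
      ((tendsto_avg_sub_div_sq hψ x).const_mul q)
    have hle : ∀ᶠ r : ℝ in nhdsWithin 0 (Ioi 0), β ≤ p * ((φ x - avg n r φ x) / r ^ 2)
        + q * ((ψ x - avg n r ψ x) / r ^ 2) := by
      filter_upwards [self_mem_nhdsWithin, nhdsWithin_le_nhds (eventually_lt_nhds one_pos)]
        with r hr hr1
      have hr0 : (0 : ℝ) < r := hr
      have := h r hr0
      rw [min_eq_left (pow_le_one₀ hr0.le hr1.le)] at this
      rw [mul_div_assoc', mul_div_assoc', ← add_div, le_div_iff₀ (by positivity)]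
      exact this
    have h3 := ge_of_tendsto hl hle
    set X := p * (-∑ i : Fin n, dd2 n (EuclideanSpace.single i 1) φ x)
      + q * (-∑ i : Fin n, dd2 n (EuclideanSpace.single i 1) ψ x)
    have h4 : β ≤ moment n / (2 * n) * X := by simp only [X]; linarith
    have hn1 : (1 : ℝ) ≤ n := by exact_mod_cast hn
    have hm := moment_pos hn
    have h5 : moment n / (2 * n) ≤ 1 := by
      rw [div_le_one (by positivity)]
      linarith [moment_le_one n]
    have hX : 0 < X := by
      by_contra hneg
      have : moment n / (2 * n) * X ≤ 0 :=
        mul_nonpos_of_nonneg_of_nonpos (by positivity) (not_lt.1 hneg)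
      linarith
    have h6 : moment n / (2 * n) * X ≤ 1 * X := by gcongr
    have h7 : c₀ * β ≤ 1 * β := by gcongr; exact min_le_right _ _
    linarith
  have j1 := fracSec_integrableOn hn μ hφ x
  have j2 := fracSec_integrableOn hn μ hψ x
  have h3 : c₀ * β * μ.real (Ioo 0 1)
      ≤ p * (∫ s in Ioo (0 : ℝ) 1, fracSec n s φ x ∂μ)
        + q * ∫ s in Ioo (0 : ℝ) 1, fracSec n s ψ x ∂μ := by
    rw [← integral_const_mul, ← integral_const_mul, ← integral_add (j1.const_mul p)
        (j2.const_mul q)]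
    have := setIntegral_mono_on (μ := μ) (integrable_const (c₀ * β)) ((j1.const_mul p).add
      (j2.const_mul q)) measurableSet_Ioo h1
    simp only [setIntegral_const, smul_eq_mul, Pi.add_apply] at this
    linarith
  have h4 : 1 - μ.real {0} = μ.real (Ioo 0 1) + μ.real {1} := by
    have hu : Icc (0 : ℝ) 1 = {0} ∪ (Ioo 0 1 ∪ {1}) := by
      rw [Ioo_union_right one_pos, ← Ioc_union_left zero_le_one, union_comm]
    have hm : μ.real (Icc 0 1) = 1 := by simp [Measure.real, hμ]
    rw [hu, measureReal_union (by simp) (measurableSet_Ioo.union (measurableSet_singleton 1)),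
      measureReal_union (by simp) (measurableSet_singleton 1)] at hm
    linarith
  rw [h4]
  simp only [opPos]
  have h5 := mul_le_mul_of_nonneg_left h2 (measureReal_nonneg (μ := μ) (s := {1}))
  linarith

/-! ### Weighted sums of operators -/

/-- The weighted sum of the masses at order zero. -/
def zeroMass {J : ℕ} (μ : Fin J → Measure ℝ) (a : Fin J → ℝ) : ℝ := ∑ j, a j * (μ j).real {0}

/-- The weighted sum of the operators with their zero-order parts removed. -/
def opSum {J : ℕ} (n : ℕ) (μ : Fin J → Measure ℝ) (a : Fin J → ℝ) (φ : En n → ℝ) (x : En n) : ℝ :=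
  ∑ j, a j * opPos n (μ j) φ x

lemma sum_mul_opMu {J n : ℕ} (hn : 0 < n) {μ : Fin J → Measure ℝ}
    (hμ : ∀ j, IsProbabilityMeasure (μ j)) (hμ1 : ∀ j, μ j (Icc 0 1) = 1) (a : Fin J → ℝ)
    {φ : En n → ℝ} (hφ : SmoothBdd n φ) (x : En n) :
    ∑ j, a j * opMu n (μ j) φ x = zeroMass μ a * φ x + opSum n μ a φ x := by
  rw [zeroMass, opSum, Finset.sum_mul, ← Finset.sum_add_distrib]
  refine Finset.sum_congr rfl fun j _ => ?_
  have := hμ j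
  rw [opMu_eq hn (hμ1 j) hφ]; ring

lemma hasDerivAt_opSum {J n : ℕ} (hn : 0 < n) {μ : Fin J → Measure ℝ}
    (hμ : ∀ j, IsProbabilityMeasure (μ j)) (a : Fin J → ℝ) {φ : En n → ℝ} {e : En n}
    (he : ‖e‖ = 1) (hφ : SmoothBdd n φ) (hφ' : SmoothBdd n (dd n e φ)) (x : En n) (t₀ : ℝ) :
    HasDerivAt (fun t : ℝ => zeroMass μ a * φ (x + t • e) + opSum n μ a φ (x + t • e))
      (zeroMass μ a * dd n e φ (x + t₀ • e) + opSum n μ a (dd n e φ) (x + t₀ • e)) t₀ := by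
  refine ((hasDerivAt_line hφ.1 x e t₀).const_mul _).add ?_
  refine HasDerivAt.fun_sum fun j _ => ?_
  have := hμ j
  exact (hasDerivAt_opPos hn (μ j) he hφ hφ' x t₀).const_mul _

lemma zeroMass_nonneg {J : ℕ} (μ : Fin J → Measure ℝ) {a : Fin J → ℝ} (ha : ∀ j, 0 ≤ a j) :
    0 ≤ zeroMass μ a :=
  Finset.sum_nonneg fun j _ => mul_nonneg (ha j) measureReal_nonneg

lemma zeroMass_le {J : ℕ} {μ : Fin J → Measure ℝ} {a : Fin J → ℝ} (ha : ∀ j, 0 ≤ a j) {ω : ℝ}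
    (hω : ∀ j, (μ j).real {0} ≤ ω) : zeroMass μ a ≤ ω * ∑ j, a j := by
  rw [zeroMass, Finset.mul_sum]
  exact Finset.sum_le_sum fun j _ => by
    rw [mul_comm ω]; exact mul_le_mul_of_nonneg_left (hω j) (ha j)

lemma opSum_lower {J n : ℕ} {c₀ : ℝ} (hc : ∀ (μ : Measure ℝ), IsProbabilityMeasure μ →
      μ (Icc 0 1) = 1 →
    ∀ (φ ψ : En n → ℝ), SmoothBdd n φ → SmoothBdd n ψ → ∀ (x : En n) (p q β : ℝ), 0 < β →
      (∀ r, 0 < r → β * min (r ^ 2) 1 ≤ p * (φ x - avg n r φ x) + q * (ψ x - avg n r ψ x)) →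
      c₀ * β * (1 - μ.real {0}) ≤ p * opPos n μ φ x + q * opPos n μ ψ x)
    {μ : Fin J → Measure ℝ} (hμ : ∀ j, IsProbabilityMeasure (μ j))
    (hμ1 : ∀ j, μ j (Icc 0 1) = 1) {a : Fin J → ℝ} (ha : ∀ j, 0 ≤ a j) {φ ψ : En n → ℝ}
    (hφ : SmoothBdd n φ) (hψ : SmoothBdd n ψ) (x : En n) {p q β : ℝ} (hβ : 0 < β)
    (h : ∀ r, 0 < r → β * min (r ^ 2) 1 ≤
      p * (φ x - avg n r φ x) + q * (ψ x - avg n r ψ x)) :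
    c₀ * β * (∑ j, a j - zeroMass μ a) ≤ p * opSum n μ a φ x + q * opSum n μ a ψ x := by
  rw [zeroMass, opSum, opSum, ← Finset.sum_sub_distrib, Finset.mul_sum, Finset.mul_sum,
    Finset.mul_sum, ← Finset.sum_add_distrib]
  refine Finset.sum_le_sum fun j _ => ?_
  have := mul_le_mul_of_nonneg_left (hc (μ j) (hμ j) (hμ1 j) φ ψ hφ hψ x p q β hβ h) (ha j)
  linarith

/-! ### Consequences of one-sided difference bounds in one variable -/

lemma abs_deriv_le_of_sub_le {k : ℝ → ℝ} {k' γ : ℝ} (hk : HasDerivAt k k' 0)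
    (h : ∀ᶠ t in nhds (0 : ℝ), k t - k 0 ≤ γ * |t|) : |k'| ≤ γ := by
  have key : ∀ (k : ℝ → ℝ) (k' : ℝ), HasDerivAt k k' 0 →
      (∀ᶠ t in nhds (0 : ℝ), k t - k 0 ≤ γ * |t|) → k' ≤ γ := by
    intro k k' hk h
    have h1 := (hasDerivAt_iff_tendsto_slope_zero.1 hk).mono_left
      (nhdsWithin_mono 0 (show Ioi (0 : ℝ) ⊆ {0}ᶜ from fun t ht => ne_of_gt ht))
    refine le_of_tendsto h1 ?_
    filter_upwards [self_mem_nhdsWithin, nhdsWithin_le_nhds h] with t ht hh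
    have ht0 : (0 : ℝ) < t := ht
    rw [abs_of_pos ht0] at hh
    rw [zero_add, smul_eq_mul, inv_mul_le_iff₀ ht0]
    linarith
  rw [abs_le']
  refine ⟨key k k' hk h, key (fun t => k (-t)) (-k') ?_ ?_⟩
  · have h2 : HasDerivAt k k' (-0) := by rwa [neg_zero]
    exact (h2.scomp 0 (hasDerivAt_neg 0)).congr_deriv (by simp)
  · have h3 : Tendsto (fun t : ℝ => -t) (nhds 0) (nhds 0) := by
      simpa using (continuous_neg (G := ℝ)).tendsto 0
    filter_upwards [h3.eventually h] with t ht
    simpa using ht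

lemma deriv_deriv_le_of_add_sub_le {k k' : ℝ → ℝ} {k'' γ : ℝ} (hk : ∀ t, HasDerivAt k (k' t) t)
    (hk' : HasDerivAt k' k'' 0)
    (h : ∀ᶠ t in nhds (0 : ℝ), k t + k (-t) - 2 * k 0 ≤ γ * t ^ 2) : k'' ≤ γ := by
  have hneg : ∀ (l : ℝ → ℝ) (l' t : ℝ), HasDerivAt l l' (-t) →
      HasDerivAt (fun t => l (-t)) (-l') t := fun l l' t hl =>
    (hl.scomp t (hasDerivAt_neg t)).congr_deriv (by simp)
  have hf : ∀ t, HasDerivAt (fun t => k t + k (-t) - 2 * k 0) (k' t - k' (-t)) t := fun t =>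
    (((hk t).add (hneg k _ t (hk (-t)))).sub_const _).congr_deriv (by ring)
  have hq : HasDerivAt (fun t => k' t - k' (-t)) (2 * k'') 0 := by
    have h0 : HasDerivAt k' k'' (-0) := by rwa [neg_zero]
    exact (hk'.sub (hneg k' _ 0 h0)).congr_deriv (by ring)
  have hlim : Tendsto (fun t : ℝ => (k' t - k' (-t)) / (2 * t))
      (nhdsWithin 0 (Ioi 0)) (nhds k'') := by
    have h1 := (hasDerivAt_iff_tendsto_slope_zero.1 hq).mono_left
      (nhdsWithin_mono 0 (show Ioi (0 : ℝ) ⊆ {0}ᶜ from fun t ht => ne_of_gt ht))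
    have h2 := h1.const_mul (1 / 2 : ℝ)
    convert h2 using 2
    · simp; ring
    · ring
  have hL : Tendsto (fun t : ℝ => (k t + k (-t) - 2 * k 0) / t ^ 2) (nhdsWithin 0 (Ioi 0))
      (nhds k'') := by
    refine HasDerivAt.lhopital_zero_nhdsGT (f' := fun t => k' t - k' (-t))
      (g' := fun t => 2 * t) (Eventually.of_forall hf) (Eventually.of_forall fun t => ?_) ?_ ?_ ?_
      hlim
    · simpa using hasDerivAt_pow 2 t
    · filter_upwards [self_mem_nhdsWithin] with t ht
      have : (0 : ℝ) < t := ht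
      positivity
    · have h1 := (hf 0).continuousAt.tendsto
      have h2 : k 0 + k (-0) - 2 * k 0 = 0 := by rw [neg_zero]; ring
      rw [h2] at h1
      exact h1.mono_left nhdsWithin_le_nhds
    · have h1 : Tendsto (fun t : ℝ => t ^ 2) (nhds 0) (nhds (0 ^ 2)) := (continuous_pow 2).tendsto 0
      rw [zero_pow two_ne_zero] at h1
      exact h1.mono_left nhdsWithin_le_nhds
  refine le_of_tendsto hL ?_
  filter_upwards [self_mem_nhdsWithin, nhdsWithin_le_nhds h] with t ht hh
  have ht0 : (0 : ℝ) < t := ht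
  rwa [div_le_iff₀ (by positivity)]

/-! ### The equation along a line, and the resulting interior estimates -/

lemma abs_inner_le_of_data {U T u N₀ a₀ M : ℝ} (ha₀ : 0 ≤ a₀) (hN : 0 ≤ N₀) (hu : |u| ≤ M)
    (hU : U = u - M) (hT : -N₀ ≤ a₀ * u + T) :
    2 * U * T ≤ 4 * M * N₀ + a₀ * (4 * M ^ 2) := by
  obtain ⟨h1, h2⟩ := abs_le.1 hu
  have hM : 0 ≤ M := (abs_nonneg u).trans hu
  subst hU
  have e1 : 0 ≤ (M - u) * (a₀ * u + T + N₀) := mul_nonneg (by linarith) (by linarith)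
  have e2 : 0 ≤ N₀ * (M + u) := mul_nonneg hN (by linarith)
  have e3 : (M - u) * u ≤ 2 * M ^ 2 := by nlinarith
  have e4 := mul_le_mul_of_nonneg_left e3 ha₀
  nlinarith

lemma dd_sub_const {n : ℕ} (e : En n) (φ : En n → ℝ) (c : ℝ) :
    dd n e (fun y => φ y - c) = dd n e φ := by
  ext x
  simp only [dd, fderiv_sub_const]

lemma opSum_sub_const {J n : ℕ} (μ : Fin J → Measure ℝ) (a : Fin J → ℝ) (φ : En n → ℝ) (c : ℝ) :
    opSum n μ a (fun y => φ y - c) = opSum n μ a φ := by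
  ext x
  simp only [opSum, opPos_sub_const]

lemma norm_lt_of_sub_lt {n : ℕ} {y c : En n} {r s t : ℝ} (h : ‖y - c‖ < r) (hc : ‖c‖ < s)
    (hrs : r + s ≤ t) : ‖y‖ < t := by
  have := norm_add_le (y - c) c
  rw [sub_add_cancel] at this
  linarith

/-- The interior gradient estimate for a solution of a family of linear inequalities. -/
lemma exists_gradient_estimate {n : ℕ} (hn : 0 < n) {θ₀ : ℝ} (hθ₀ : 0 < θ₀) :
    ∃ C : ℝ, 0 < C ∧ ∀ (J : ℕ) (μ : Fin J → Measure ℝ), (∀ j, IsProbabilityMeasure (μ j)) →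
    (∀ j, μ j (Icc 0 1) = 1) → ∀ ω : ℝ, (ω = 0 ∨ ω = 1) → (∀ j, (μ j).real {0} ≤ ω) →
    ∀ u : En n → ℝ, SmoothBdd n u → (∀ e, ‖e‖ = 1 → SmoothBdd n (dd n e u)) →
    ∀ R Minf MR N₀ γ : ℝ, 0 < R → 0 ≤ N₀ → 0 ≤ γ → (∀ x, |u x| ≤ Minf) →
    (∀ x, ‖x‖ < R → |u x| ≤ MR) →
    (∀ x, ‖x‖ < R → ∃ a : Fin J → ℝ, (∀ j, 0 ≤ a j) ∧ θ₀ ≤ ∑ j, a j ∧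
      (∀ e, ‖e‖ = 1 → |zeroMass μ a * dd n e u x + opSum n μ a (dd n e u) x| ≤ γ) ∧
      -N₀ ≤ zeroMass μ a * u x + opSum n μ a u x) →
    ∀ e, ‖e‖ = 1 → ∀ y, ‖y‖ < 3 * R / 4 →
      dd n e u y ≤ C * ((ω + R⁻¹) * Minf + (1 + R) * R⁻¹ * √N₀ * √MR + (1 + R ^ 2) * γ) := by
  obtain ⟨c₀, hc₀, hlow⟩ := exists_opPos_lower hn
  obtain ⟨C, hC, hD⟩ := exists_bernstein_estimate hn hθ₀ hc₀
  obtain ⟨K, hK, hKb⟩ := exists_avg_dd_le n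
  refine ⟨C * (48 + 16 * K), by positivity, ?_⟩
  intro J μ hμ hμ1 ω hω hωμ u hu hdu R Minf MR N₀ γ hR hN₀ hγ hMinf hMR hdata e he c hc
  have hω0 : 0 ≤ ω := by rcases hω with h | h <;> simp [h]
  have hωs : √ω = ω := by rcases hω with h | h <;> simp [h]
  have hω1 : ω ≤ 1 := by rcases hω with h | h <;> simp [h]
  have hMinf0 : 0 ≤ Minf := (abs_nonneg _).trans (hMinf 0)
  have hMR0 : 0 ≤ MR := (abs_nonneg _).trans (hMR 0 (by simpa using hR))
  obtain ⟨M, hMdef⟩ : ∃ M, M = min MR Minf := ⟨_, rfl⟩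
  have hM0 : 0 ≤ M := hMdef ▸ le_min hMR0 hMinf0
  have hMle : M ≤ Minf := hMdef ▸ min_le_right _ _
  have hMleR : M ≤ MR := hMdef ▸ min_le_left _ _
  have huM : ∀ x, ‖x‖ < R → |u x| ≤ M := fun x hx => hMdef ▸ le_min (hMR x hx) (hMinf x)
  have hU : SmoothBdd n (fun y => u y - M) := hu.sub_const M
  have hUinf : ∀ y, |u y - M| ≤ 2 * Minf := fun y => by
    have := abs_sub (u y) M
    rw [abs_of_nonneg hM0] at this
    linarith [hMinf y]
  have key := hD e he (fun y => u y - M) hU.1 c (R / 8) ((2 + 2 * K) * Minf) (2 * M) γ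
    (4 * M * N₀) (4 * M ^ 2) ω (by positivity) (by positivity) (by positivity) hγ (by positivity)
    (by positivity) hω0 ?_ ?_ ?_
  · rw [dd_sub_const] at key
    refine key.trans ?_
    rw [mul_assoc C]
    refine mul_le_mul_of_nonneg_left ?_ hC.le
    have hsN : √(4 * M * N₀) ≤ 2 * (√N₀ * √MR) := by
      rw [← Real.sqrt_mul hN₀, Real.sqrt_le_iff]
      refine ⟨by positivity, ?_⟩
      rw [mul_pow, Real.sq_sqrt (by positivity)]
      nlinarith [mul_le_mul_of_nonneg_right hMleR hN₀]
    have hsZ : √(ω * (4 * M ^ 2)) = ω * (2 * M) := by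
      rw [Real.sqrt_mul hω0, hωs, show (4 : ℝ) * M ^ 2 = (2 * M) ^ 2 by ring,
        Real.sqrt_sq (by positivity)]
    rw [hsZ]
    have hi : 0 < R⁻¹ := by positivity
    have hiR : R * R⁻¹ = 1 := mul_inv_cancel₀ hR.ne'
    have hi8 : (R / 8)⁻¹ = 8 * R⁻¹ := by rw [inv_div]; ring
    have e0 : (1 + R / 8) * (R / 8)⁻¹ = 8 * R⁻¹ + 1 := by
      rw [hi8]; linear_combination hiR
    have hd : ∀ z : ℝ, z / (R / 8) = z * (8 * R⁻¹) := fun z => by rw [div_eq_mul_inv, hi8]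
    simp only [e0, hd]
    generalize hS : √N₀ * √MR = S at hsN
    have hS0 : 0 ≤ S := hS ▸ by positivity
    have e1 : (1 + R) * R⁻¹ * √N₀ * √MR = (R⁻¹ + 1) * S := by
      rw [mul_assoc, hS]; linear_combination S * hiR
    rw [e1]
    generalize R⁻¹ = i at hi hiR
    have f1 : (8 * i + 1) * (√(4 * M * N₀) + ω * (2 * M)) ≤
        (8 * i + 1) * (2 * S) + 16 * (i * Minf) + 2 * (ω * Minf) := by
      have g1 : ω * M ≤ ω * Minf := mul_le_mul_of_nonneg_left hMle hω0
      have g2 : ω * M ≤ Minf := by nlinarith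
      have g3 := mul_le_mul_of_nonneg_left g2 hi.le
      have g4 := mul_le_mul_of_nonneg_left hsN (show 0 ≤ 8 * i + 1 by positivity)
      linarith
    have f2 : 2 * M * (8 * i) ≤ 16 * (i * Minf) := by
      nlinarith [mul_le_mul_of_nonneg_left hMle hi.le]
    have f3 : (1 + (R / 8) ^ 2) * γ ≤ (1 + R ^ 2) * γ :=
      mul_le_mul_of_nonneg_right (by nlinarith [sq_nonneg R]) hγ
    have p1 : 0 ≤ i * S := by positivity
    have p2 : 0 ≤ i * Minf := by positivity
    have p3 : 0 ≤ ω * Minf := by positivity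
    have p4 : 0 ≤ (1 + R ^ 2) * γ := by positivity
    have q1 := mul_nonneg hK.le p1
    have q2 := mul_nonneg hK.le hS0
    have q3 := mul_nonneg hK.le p3
    have q4 := mul_nonneg hK.le p4
    linarith
  · intro y hy
    have := abs_sub (u y) M
    rw [abs_of_nonneg hM0] at this
    linarith [huM y (norm_lt_of_sub_lt hy hc (by linarith))]
  · intro y r hr
    have hr0 : 0 < r := lt_trans (by positivity) hr
    refine ⟨(abs_avg_le hU.1.continuous hUinf).trans ?_, ((hKb e he _ hU.1 _ hUinf r hr0 y).1).trans ?_⟩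
    · nlinarith [mul_nonneg hK.le hMinf0]
    · refine div_le_div₀ (by positivity) ?_ (by positivity) hr.le
      linarith
  · intro x hx
    have hxR : ‖x‖ < R := norm_lt_of_sub_lt (r := R / 4) (lt_of_le_of_lt hx (by linarith)) hc
      (by linarith)
    obtain ⟨a, ha, hθ, hw, hL⟩ := hdata x hxR
    have h1μ : ∀ j, (μ j).real {0} ≤ 1 := fun j => (hωμ j).trans hω1
    refine ⟨∑ j, a j, zeroMass μ a, opSum n μ a (dd n e u) x, opSum n μ a u x, hθ,
      zeroMass_nonneg μ ha, by simpa using zeroMass_le ha h1μ, zeroMass_le ha hωμ, ?_, ?_, ?_⟩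
    · rw [dd_sub_const]
      exact (le_abs_self _).trans (hw e he)
    · exact abs_inner_le_of_data (zeroMass_nonneg μ ha) hN₀ (huM x hxR) rfl hL
    · intro β p q hβ h
      have := opSum_lower hlow hμ hμ1 ha (hdu e he) hU x hβ (p := p) (q := q)
        (by simpa only [dd_sub_const] using h)
      rwa [opSum_sub_const] at this

/-- The interior one-sided second derivative estimate for a solution of a family of linear
inequalities, in terms of a gradient bound. -/
lemma exists_second_estimate {n : ℕ} (hn : 0 < n) {θ₀ : ℝ} (hθ₀ : 0 < θ₀) :
    ∃ C : ℝ, 0 < C ∧ ∀ (J : ℕ) (μ : Fin J → Measure ℝ), (∀ j, IsProbabilityMeasure (μ j)) →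
    (∀ j, μ j (Icc 0 1) = 1) →
    ∀ (u : En n → ℝ) (e : En n), ‖e‖ = 1 → ContDiff ℝ (⊤ : ℕ∞) u → SmoothBdd n (dd n e u) →
    SmoothBdd n (dd n e (dd n e u)) →
    ∀ R Minf E γ₁ γ₂ : ℝ, 0 < R → 0 ≤ E → 0 ≤ γ₁ → 0 ≤ γ₂ → (∀ x, |u x| ≤ Minf) →
    (∀ x, ‖x‖ < 3 * R / 4 → |dd n e u x| ≤ E) →
    (∀ x, ‖x‖ < R → ∃ a : Fin J → ℝ, (∀ j, 0 ≤ a j) ∧ θ₀ ≤ ∑ j, a j ∧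
      |zeroMass μ a * dd n e u x + opSum n μ a (dd n e u) x| ≤ γ₁ ∧
      zeroMass μ a * dd n e (dd n e u) x + opSum n μ a (dd n e (dd n e u)) x ≤ γ₂) →
    ∀ y, ‖y‖ < R / 2 →
      dd n e (dd n e u) y ≤ C * (Minf * R⁻¹ ^ 2 + E * R⁻¹ + (1 + R ^ 2) * (R⁻¹ * γ₁ + γ₂)) := by
  obtain ⟨c₀, hc₀, hlow⟩ := exists_opPos_lower hn
  obtain ⟨C, hC, hD⟩ := exists_bernstein_estimate hn hθ₀ hc₀
  obtain ⟨K, hK, hKb⟩ := exists_avg_dd_le n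
  refine ⟨C * (16 + 64 * K), by positivity, ?_⟩
  intro J μ hμ hμ1 u e he hu hw hW R Minf E γ₁ γ₂ hR hE hγ₁ hγ₂ hMinf hEb hdata c hc
  have hMinf0 : 0 ≤ Minf := (abs_nonneg _).trans (hMinf 0)
  have h1μ : ∀ j, (μ j).real {0} ≤ 1 := fun j => by
    have := hμ j
    exact measureReal_le_one
  have key := hD e he (dd n e u) hw.1 c (R / 8) (K * Minf / (R / 8)) E γ₂ (2 * E * γ₁) 0 1
    (by positivity) (by positivity) hE hγ₂ (by positivity) le_rfl zero_le_one ?_ ?_ ?_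
  · refine key.trans ?_
    rw [mul_assoc C]
    refine mul_le_mul_of_nonneg_left ?_ hC.le
    rw [mul_zero, Real.sqrt_zero, add_zero]
    have hi : 0 < R⁻¹ := by positivity
    have hiR : R * R⁻¹ = 1 := mul_inv_cancel₀ hR.ne'
    have hi8 : (R / 8)⁻¹ = 8 * R⁻¹ := by rw [inv_div]; ring
    have e0 : (1 + R / 8) * (R / 8)⁻¹ = 8 * R⁻¹ + 1 := by
      rw [hi8]; linear_combination hiR
    have hd : ∀ z : ℝ, z / (R / 8) = z * (8 * R⁻¹) := fun z => by rw [div_eq_mul_inv, hi8]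
    simp only [e0, hd]
    have hs : (1 + R) * √(2 * E * γ₁) ≤ E + (1 + R ^ 2) * γ₁ := by
      have h1 : (1 + R) * √(2 * E * γ₁) = √((1 + R) ^ 2 * (2 * E * γ₁)) := by
        rw [Real.sqrt_mul (sq_nonneg (1 + R)), Real.sqrt_sq (by positivity)]
      rw [h1, Real.sqrt_le_iff]
      refine ⟨by positivity, ?_⟩
      have h2 : (1 + R) ^ 2 ≤ 2 * (1 + R ^ 2) := by nlinarith [sq_nonneg (1 - R)]
      have h3 := mul_le_mul_of_nonneg_right h2 (show 0 ≤ 2 * E * γ₁ by positivity)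
      nlinarith [sq_nonneg (E - (1 + R ^ 2) * γ₁)]
    have f1 : (8 * R⁻¹ + 1) * √(2 * E * γ₁) ≤ 8 * (R⁻¹ * (E + (1 + R ^ 2) * γ₁)) := by
      have h1 := mul_le_mul_of_nonneg_left hs hi.le
      have h2 : R⁻¹ * ((1 + R) * √(2 * E * γ₁)) = (R⁻¹ + 1) * √(2 * E * γ₁) := by
        linear_combination √(2 * E * γ₁) * hiR
      have h3 := Real.sqrt_nonneg (2 * E * γ₁)
      linarith
    clear e0 hi8 hd
    generalize R⁻¹ = i at hi f1 ⊢
    have f3 : (1 + (R / 8) ^ 2) * γ₂ ≤ (1 + R ^ 2) * γ₂ :=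
      mul_le_mul_of_nonneg_right (by nlinarith [sq_nonneg R]) hγ₂
    have p1 : 0 ≤ Minf * i ^ 2 := by positivity
    have p2 : 0 ≤ E * i := by positivity
    have p3 : 0 ≤ (1 + R ^ 2) * (i * γ₁) := by positivity
    have p4 : 0 ≤ (1 + R ^ 2) * γ₂ := by positivity
    have q2 := mul_nonneg hK.le p2
    have q3 := mul_nonneg hK.le p3
    have q4 := mul_nonneg hK.le p4
    linarith
  · intro y hy
    exact hEb y (norm_lt_of_sub_lt hy hc (by linarith))
  · intro y r hr
    have hr0 : 0 < r := lt_trans (by positivity) hr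
    obtain ⟨h1, h2⟩ := hKb e he u hu Minf hMinf r hr0 y
    refine ⟨h1.trans ?_, h2.trans ?_⟩
    · gcongr
    · rw [div_div, ← pow_two]
      gcongr
  · intro x hx
    have hx' : ‖x‖ < 3 * R / 4 := norm_lt_of_sub_lt (r := R / 4) (lt_of_le_of_lt hx (by linarith))
      hc (by linarith)
    obtain ⟨a, ha, hθ, hL, hL2⟩ := hdata x (by linarith)
    have ha₀ := zeroMass_nonneg μ ha
    have ha1 : zeroMass μ a ≤ 1 * ∑ j, a j := zeroMass_le ha h1μ
    refine ⟨∑ j, a j, zeroMass μ a, opSum n μ a (dd n e (dd n e u)) x, opSum n μ a (dd n e u) x, hθ,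
      ha₀, by simpa using ha1, ha1, hL2, ?_, ?_⟩
    · have h1 : dd n e u x * (zeroMass μ a * dd n e u x + opSum n μ a (dd n e u) x) ≤ E * γ₁ := by
        refine (le_abs_self _).trans ?_
        rw [abs_mul]
        exact mul_le_mul (hEb x hx') hL (abs_nonneg _) hE
      nlinarith [mul_nonneg ha₀ (sq_nonneg (dd n e u x))]
    · intro β p q hβ h
      exact opSum_lower hlow hμ hμ1 ha hW hw x hβ h

lemma eventually_line_mem_ball {n : ℕ} {x : En n} {R : ℝ} (hx : x ∈ ball (0 : En n) R) (e : En n) :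
    ∀ᶠ t in nhds (0 : ℝ), x + t • e ∈ ball (0 : En n) R := by
  have h : Continuous fun t : ℝ => x + t • e := by fun_prop
  exact h.continuousAt.eventually (isOpen_ball.mem_nhds (by simpa using hx))

/-- The linear inequalities implied by the convex equation at a point. -/
lemma data_of_equation {J n : ℕ} (hn : 0 < n) {μ : Fin J → Measure ℝ}
    (hμ : ∀ j, IsProbabilityMeasure (μ j)) (hμ1 : ∀ j, μ j (Icc 0 1) = 1)
    {F : (Fin J → ℝ) → ℝ} {α : Fin J → (Fin J → ℝ) → ℝ} (hα : ∀ j p, 0 ≤ α j p)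
    (hconv : ∀ p q : Fin J → ℝ, ∑ j, α j p * (q j - p j) ≤ F q - F p)
    {R : ℝ} {f : En n → ℝ} {g : Fin J → En n → ℝ} {u : En n → ℝ} (hu : SmoothBdd n u)
    (hdu : ∀ e, ‖e‖ = 1 → SmoothBdd n (dd n e u))
    (hddu : ∀ e, ‖e‖ = 1 → SmoothBdd n (dd n e (dd n e u)))
    (heq : ∀ x ∈ ball (0 : En n) R, F (fun j => opMu n (μ j) u x - g j x) = f x)
    {x : En n} (hx : x ∈ ball (0 : En n) R) {a : Fin J → ℝ}
    (ha : a = fun j => α j (fun j => opMu n (μ j) u x - g j x)) :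
    (f x - F (fun j => -(g j x)) ≤ zeroMass μ a * u x + opSum n μ a u x) ∧
    (∀ (Lf : ℝ) (Lg : Fin J → ℝ),
      (∀ y ∈ ball (0 : En n) R, f y - f x ≤ Lf * dist y x) →
      (∀ j, ∀ y ∈ ball (0 : En n) R, g j y - g j x ≤ Lg j * dist y x) →
      ∀ e, ‖e‖ = 1 → |zeroMass μ a * dd n e u x + opSum n μ a (dd n e u) x| ≤
        Lf + ∑ j, a j * Lg j) ∧
    (∀ e, ‖e‖ = 1 → ∀ (Qf : ℝ) (Qg : Fin J → ℝ),
      (∀ h : ℝ, x + h • e ∈ ball (0 : En n) R → x - h • e ∈ ball (0 : En n) R →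
        f (x + h • e) + f (x - h • e) - 2 * f x ≤ Qf * h ^ 2) →
      (∀ j, ∀ h : ℝ, x + h • e ∈ ball (0 : En n) R → x - h • e ∈ ball (0 : En n) R →
        g j (x + h • e) + g j (x - h • e) - 2 * g j x ≤ Qg j * h ^ 2) →
      zeroMass μ a * dd n e (dd n e u) x + opSum n μ a (dd n e (dd n e u)) x ≤
        Qf + ∑ j, a j * Qg j) := by
  have ha0 : ∀ j, 0 ≤ a j := fun j => by rw [ha]; exact hα j _
  have hsum : ∀ y, zeroMass μ a * u y + opSum n μ a u y = ∑ j, a j * opMu n (μ j) u y :=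
    fun y => (sum_mul_opMu hn hμ hμ1 a hu y).symm
  have hc : ∀ q : Fin J → ℝ,
      ∑ j, a j * q j - (∑ j, a j * opMu n (μ j) u x - ∑ j, a j * g j x) ≤ F q - f x := by
    intro q
    have := hconv (fun j => opMu n (μ j) u x - g j x) q
    rw [heq x hx] at this
    refine le_trans (le_of_eq ?_) this
    rw [ha, ← Finset.sum_sub_distrib, ← Finset.sum_sub_distrib]
    exact Finset.sum_congr rfl fun j _ => by ring
  have hy : ∀ y ∈ ball (0 : En n) R, (∑ j, a j * opMu n (μ j) u y - ∑ j, a j * g j y) -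
      (∑ j, a j * opMu n (μ j) u x - ∑ j, a j * g j x) ≤ f y - f x := by
    intro y hyR
    have := hc (fun j => opMu n (μ j) u y - g j y)
    rw [heq y hyR] at this
    refine le_trans (le_of_eq ?_) this
    congr 1
    rw [← Finset.sum_sub_distrib]
    exact Finset.sum_congr rfl fun j _ => by ring
  refine ⟨?_, ?_, ?_⟩
  · have := hc (fun j => -(g j x))
    rw [hsum]
    simp only [mul_neg, Finset.sum_neg_distrib] at this
    linarith
  · intro Lf Lg hf hg e he
    have hk := hasDerivAt_opSum hn hμ a he hu (hdu e he) x 0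
    rw [zero_smul, add_zero] at hk
    refine abs_deriv_le_of_sub_le hk ?_
    filter_upwards [eventually_line_mem_ball hx e] with t ht
    have hd : dist (x + t • e) x = |t| := by simp [dist_eq_norm, norm_smul, he]
    have h1 := hy _ ht
    have h2 := hf _ ht
    have h3 : ∑ j, a j * (g j (x + t • e) - g j x) ≤ ∑ j, a j * Lg j * |t| :=
      Finset.sum_le_sum fun j _ => by
        rw [mul_assoc, ← hd]; exact mul_le_mul_of_nonneg_left (hg j _ ht) (ha0 j)
    simp only [mul_sub, Finset.sum_sub_distrib, ← Finset.sum_mul] at h3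
    rw [hd] at h2
    rw [zero_smul, add_zero, hsum, hsum]
    linarith
  · intro e he Qf Qg hf hg
    have hk := hasDerivAt_opSum hn hμ a he hu (hdu e he) x
    have hk' := hasDerivAt_opSum hn hμ a he (hdu e he) (hddu e he) x 0
    rw [zero_smul, add_zero] at hk'
    refine deriv_deriv_le_of_add_sub_le hk hk' ?_
    filter_upwards [eventually_line_mem_ball hx e, eventually_line_mem_ball hx (-e)] with t ht ht'
    rw [smul_neg, ← sub_eq_add_neg] at ht'
    have h1 := hy _ ht
    have h1' := hy _ ht'
    have h2 := hf t ht ht'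
    have h3 : ∑ j, a j * (g j (x + t • e) + g j (x - t • e) - 2 * g j x) ≤
        ∑ j, a j * Qg j * t ^ 2 :=
      Finset.sum_le_sum fun j _ => by
        rw [mul_assoc]; exact mul_le_mul_of_nonneg_left (hg j t ht ht') (ha0 j)
    simp only [mul_sub, mul_add, Finset.sum_sub_distrib, Finset.sum_add_distrib,
      ← Finset.sum_mul, mul_left_comm _ (2 : ℝ), ← Finset.mul_sum] at h3
    rw [zero_smul, add_zero, neg_smul, ← sub_eq_add_neg, hsum, hsum, hsum]
    linarith

lemma norm_fderiv_le_of_dd_le {n : ℕ} {u : En n → ℝ} {x : En n} {K : ℝ} (hK : 0 ≤ K)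
    (h : ∀ e : En n, ‖e‖ = 1 → |dd n e u x| ≤ K) : ‖fderiv ℝ u x‖ ≤ K := by
  refine ContinuousLinearMap.opNorm_le_of_unit_norm hK fun e he => ?_
  exact h e he

lemma abs_dd_le_of_dd_le {n : ℕ} {u : En n → ℝ} {x : En n} {K : ℝ}
    (h : ∀ e : En n, ‖e‖ = 1 → dd n e u x ≤ K) {e : En n} (he : ‖e‖ = 1) : |dd n e u x| ≤ K := by
  have h2 := h (-e) (by rwa [norm_neg])
  rw [dd, map_neg] at h2
  exact abs_le'.2 ⟨h e he, h2⟩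

/-- first and one-sided second derivative estimates for convex fully
nonlinear equations `F(𝓛_{μ₁}u − g₁, …, 𝓛_{μ_J}u − g_J) = f` in `B_R`, built from
operators of indefinite order, with a constant `C` depending only on `n` and `θ₀`
(in particular uniform in `J`). -/
theorem fully_nonlinear_indefinite_order_estimates (n : ℕ) (hn : 0 < n)
    (θ₀ : ℝ) (hθ₀ : 0 < θ₀) :
    ∃ C : ℝ, 0 < C ∧
    ∀ (J : ℕ) (μ : Fin J → Measure ℝ),
      (∀ j, IsProbabilityMeasure (μ j)) →
      (∀ j, μ j (Set.Icc (0:ℝ) 1) = 1) →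
    ∀ (F : (Fin J → ℝ) → ℝ) (α : Fin J → (Fin J → ℝ) → ℝ),
      Continuous F →
      (∀ j p, 0 ≤ α j p) →
      (∀ p, θ₀ ≤ ∑ j, α j p) →
      (∀ p q : Fin J → ℝ, ∑ j, α j p * (q j - p j) ≤ F q - F p) →
    ∀ (R : ℝ), 0 < R →
    ∀ (f : En n → ℝ) (g : Fin J → En n → ℝ) (u : En n → ℝ),
      ContDiff ℝ (⊤ : ℕ∞) u →
      (∃ Mu : ℝ, ∀ x, |u x| ≤ Mu ∧ ‖fderiv ℝ u x‖ ≤ Mu ∧ ‖fderiv ℝ (fderiv ℝ u) x‖ ≤ Mu) →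
      -- the equation
      (∀ x ∈ ball (0 : En n) R, F (fun j => opMu n (μ j) u x - g j x) = f x) →
    ∀ (ω₀ : ℝ),
      ((∀ j, μ j ({0} : Set ℝ) = 0) → ω₀ = 0) →
      (¬ (∀ j, μ j ({0} : Set ℝ) = 0) → ω₀ = 1) →
    ∀ (Minf MR N₀ Lf Ag : ℝ) (Lg : Fin J → ℝ),
      (∀ x : En n, |u x| ≤ Minf) →
      (∀ x ∈ ball (0 : En n) R, |u x| ≤ MR) →
      0 ≤ N₀ →
      -- `‖(f+g)₋‖_{L^∞(B_R)} ≤ N₀` where `g = −F(−g₁,…,−g_J)`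
      (∀ x ∈ ball (0 : En n) R, -N₀ ≤ f x + (-F (fun j => -(g j x)))) →
      0 ≤ Lf →
      (∀ x ∈ ball (0 : En n) R, ∀ y ∈ ball (0 : En n) R, |f x - f y| ≤ Lf * dist x y) →
      (∀ j, 0 ≤ Lg j) →
      (∀ j, ∀ x ∈ ball (0 : En n) R, ∀ y ∈ ball (0 : En n) R,
        |g j x - g j y| ≤ Lg j * dist x y) →
      (∀ p, ∑ j, α j p * Lg j ≤ Ag) →
      -- first derivative estimate, with `γ₁ = Lf + Ag`
      ((∀ x ∈ ball (0 : En n) (R/2),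
          ‖fderiv ℝ u x‖ ≤ C * ((ω₀ + R⁻¹) * Minf
            + (1 + R) * R⁻¹ * Real.sqrt N₀ * Real.sqrt MR + (1 + R^2) * (Lf + Ag)))
      ∧
      -- one-sided second derivative estimate under semiconcavity, with `γ₂ = Qf + Bg`
      (∀ e : En n, ‖e‖ = 1 →
        (∃ c : ℝ, ConcaveOn ℝ (ball (0 : En n) R) fun x => f x - c * ‖x‖^2) →
        (∀ j, ∃ c : ℝ, ConcaveOn ℝ (ball (0 : En n) R) fun x => g j x - c * ‖x‖^2) →
        ∀ (Qf Bg : ℝ) (Qg : Fin J → ℝ), 0 ≤ Qf → 0 ≤ Bg →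
        (∀ e' : En n, ‖e'‖ = 1 → ∀ x ∈ ball (0 : En n) R, ∀ h : ℝ,
          x + h • e' ∈ ball (0 : En n) R → x - h • e' ∈ ball (0 : En n) R →
          f (x + h • e') + f (x - h • e') - 2 * f x ≤ Qf * h^2) →
        (∀ j, 0 ≤ Qg j) →
        (∀ j, ∀ e' : En n, ‖e'‖ = 1 → ∀ x ∈ ball (0 : En n) R, ∀ h : ℝ,
          x + h • e' ∈ ball (0 : En n) R → x - h • e' ∈ ball (0 : En n) R →
          g j (x + h • e') + g j (x - h • e') - 2 * g j x ≤ Qg j * h^2) →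
        (∀ p, ∑ j, α j p * Qg j ≤ Bg) →
        ∀ x ∈ ball (0 : En n) (R/2),
          dd2 n e u x ≤ C * ((ω₀ + R⁻¹) * R⁻¹ * Minf
            + (1 + R) * (R^2)⁻¹ * Real.sqrt N₀ * Real.sqrt MR
            + (1 + R^2) * (R⁻¹ * (Lf + Ag) + (Qf + Bg))))) := by

  obtain ⟨C₁, hC₁, hG⟩ := exists_gradient_estimate hn hθ₀
  obtain ⟨C₂, hC₂, hS⟩ := exists_second_estimate hn hθ₀
  refine ⟨C₁ + C₂ * (1 + C₁), by positivity, ?_⟩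
  intro J μ hμ hμ1 F α _ hα hθ hconv R hR f g u hu hMu heq ω₀ hω0 hω1 Minf MR N₀ Lf Ag Lg hMinf hMR
    hN₀ hN hLf hf hLg hg hAg
  obtain ⟨Mu, hMu⟩ := hMu
  have huS : SmoothBdd n u := ⟨hu, Mu, fun x => (hMu x).1⟩
  have hdu : ∀ e, ‖e‖ = 1 → SmoothBdd n (dd n e u) := fun e he =>
    ⟨dd_contDiff hu e, Mu, fun x => (abs_dd_le he u x).trans (hMu x).2.1⟩
  have hddu : ∀ e, ‖e‖ = 1 → SmoothBdd n (dd n e (dd n e u)) := fun e he =>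
    ⟨dd_contDiff (dd_contDiff hu e) e, Mu, fun x => (abs_dd_dd_le hu he he x).trans (hMu x).2.2⟩
  have hAg0 : 0 ≤ Ag :=
    (Finset.sum_nonneg fun j _ => mul_nonneg (hα j 0) (hLg j)).trans (hAg 0)
  have hγ : 0 ≤ Lf + Ag := by positivity
  have hMinf0 : 0 ≤ Minf := (abs_nonneg _).trans (hMinf 0)
  have hω : (ω₀ = 0 ∨ ω₀ = 1) ∧ ∀ j, (μ j).real {0} ≤ ω₀ := by
    by_cases h : ∀ j, μ j ({0} : Set ℝ) = 0
    · refine ⟨Or.inl (hω0 h), fun j => ?_⟩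
      rw [hω0 h, measureReal_def, h j, ENNReal.toReal_zero]
    · refine ⟨Or.inr (hω1 h), fun j => ?_⟩
      have := hμ j
      rw [hω1 h]
      exact measureReal_le_one
  have hω₀ : 0 ≤ ω₀ := by rcases hω.1 with h | h <;> simp [h]
  have hgrad : ∀ x ∈ ball (0 : En n) R, ∀ e, ‖e‖ = 1 →
      |zeroMass μ (fun j => α j (fun j => opMu n (μ j) u x - g j x)) * dd n e u x +
        opSum n μ (fun j => α j (fun j => opMu n (μ j) u x - g j x)) (dd n e u) x| ≤ Lf + Ag := by
    intro x hx e he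
    have h := (data_of_equation hn hμ hμ1 hα hconv huS hdu hddu heq hx rfl).2.1 Lf Lg
      (fun y hy => (le_abs_self _).trans (hf y hy x hx))
      (fun j y hy => (le_abs_self _).trans (hg j y hy x hx)) e he
    exact h.trans (by gcongr; exact hAg _)
  obtain ⟨P, hP⟩ : ∃ P, P = (ω₀ + R⁻¹) * Minf + (1 + R) * R⁻¹ * √N₀ * √MR +
    (1 + R ^ 2) * (Lf + Ag) := ⟨_, rfl⟩
  have hP0 : 0 ≤ P := by rw [hP]; positivity
  have hfirst : ∀ x : En n, ‖x‖ < 3 * R / 4 → ∀ e, ‖e‖ = 1 → |dd n e u x| ≤ C₁ * P := by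
    intro x hx e he
    refine abs_dd_le_of_dd_le (fun e he => ?_) he
    rw [hP]
    refine hG J μ hμ hμ1 ω₀ hω.1 hω.2 u huS hdu R Minf MR N₀ (Lf + Ag) hR hN₀ hγ hMinf
      (fun x hx => hMR x (by simpa using hx)) (fun x hx => ?_) e he x hx
    have hx : x ∈ ball (0 : En n) R := by simpa using hx
    refine ⟨fun j => α j (fun j => opMu n (μ j) u x - g j x), fun j => hα j _, hθ _, hgrad x hx, ?_⟩
    have h := (data_of_equation hn hμ hμ1 hα hconv huS hdu hddu heq hx rfl).1
    have := hN x hx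
    linarith
  refine ⟨fun x hx => ?_, ?_⟩
  · rw [mem_ball_zero_iff] at hx
    rw [← hP]
    refine (norm_fderiv_le_of_dd_le (by positivity)
      (hfirst x (by linarith))).trans (mul_le_mul_of_nonneg_right ?_ hP0)
    have : 0 ≤ C₂ * (1 + C₁) := by positivity
    linarith
  · intro e he _ _ Qf Bg Qg hQf hBg hQf2 hQg hQg2 hBgS x hx
    rw [mem_ball_zero_iff] at hx
    have h := hS J μ hμ hμ1 u e he hu (hdu e he) (hddu e he) R Minf (C₁ * P) (Lf + Ag) (Qf + Bg) hR
      (by positivity) hγ (by positivity) hMinf (fun x hx => hfirst x hx e he) ?_ x hx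
    · refine h.trans ?_
      have hi : 0 < R⁻¹ := by positivity
      have hPi : P * R⁻¹ = (ω₀ + R⁻¹) * R⁻¹ * Minf + (1 + R) * (R ^ 2)⁻¹ * √N₀ * √MR +
          (1 + R ^ 2) * (R⁻¹ * (Lf + Ag)) := by
        rw [hP]; ring
      have hsplit : (ω₀ + R⁻¹) * R⁻¹ * Minf + (1 + R) * (R ^ 2)⁻¹ * √N₀ * √MR +
          (1 + R ^ 2) * (R⁻¹ * (Lf + Ag) + (Qf + Bg)) = P * R⁻¹ + (1 + R ^ 2) * (Qf + Bg) := by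
        rw [hPi]; ring
      have h1 : Minf * R⁻¹ ^ 2 + (1 + R ^ 2) * (R⁻¹ * (Lf + Ag)) ≤ P * R⁻¹ := by
        have t1 : 0 ≤ ω₀ * R⁻¹ * Minf := by positivity
        have t2 : 0 ≤ (1 + R) * (R ^ 2)⁻¹ * √N₀ * √MR := by positivity
        rw [hPi]
        linarith
      rw [hsplit]
      have t3 : 0 ≤ P * R⁻¹ := by positivity
      have t4 : 0 ≤ (1 + R ^ 2) * (Qf + Bg) := by positivity
      have h2 : Minf * R⁻¹ ^ 2 + C₁ * P * R⁻¹ + (1 + R ^ 2) * (R⁻¹ * (Lf + Ag) + (Qf + Bg)) ≤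
          (1 + C₁) * (P * R⁻¹ + (1 + R ^ 2) * (Qf + Bg)) := by
        nlinarith [mul_nonneg hC₁.le t4]
      have h3 := mul_le_mul_of_nonneg_left h2 hC₂.le
      have h4 : 0 ≤ C₁ * (P * R⁻¹ + (1 + R ^ 2) * (Qf + Bg)) := by positivity
      linarith
    · intro y hy
      have hy : y ∈ ball (0 : En n) R := by simpa using hy
      refine ⟨fun j => α j (fun j => opMu n (μ j) u y - g j y), fun j => hα j _, hθ _,
        hgrad y hy e he, ?_⟩
      have h := (data_of_equation hn hμ hμ1 hα hconv huS hdu hddu heq hy rfl).2.2 e he Qf Qg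
        (hQf2 e he y hy) (fun j => hQg2 j e he y hy)
      exact h.trans (by gcongr; exact hBgS _)
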